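/- arXiv:1906.03668 — 2 statements merged into one kernel-verified Lean document; each statement's English description precedes it below -/
import Mathlib

section
/- Let f be a nonzero polynomial in two real variables of total degree at most k. Then the number of nodal domains of f on ℝ², i.e. the number of connected components of the set {(x,y) ∈ ℝ² | f(x,y) ≠ 0} (with the subspace topology), is at most k(k+1)/2 + 1. -/
open Matrix in
theorem abs_dotProduct_mulVec_le {ι : Type*} [Fintype ι] (A : Matrix ι ι ℝ) (v w : ι → ℝ) :
    |v ⬝ᵥ A *ᵥ w| ≤ (∑ i, ∑ j, |A i j|) * ‖v‖ * ‖w‖ := by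
  simp only [dotProduct, mulVec, Finset.mul_sum, Finset.sum_mul]
  refine (Finset.abs_sum_le_sum_abs _ _).trans (Finset.sum_le_sum fun i _ => ?_)
  refine (Finset.abs_sum_le_sum_abs _ _).trans (Finset.sum_le_sum fun j _ => ?_)
  rw [abs_mul, abs_mul]
  have h1 := norm_le_pi_norm v i
  have h2 := norm_le_pi_norm w j
  rw [Real.norm_eq_abs] at h1 h2
  calc |v i| * (|A i j| * |w j|) = |A i j| * (|v i| * |w j|) := by ring
    _ ≤ |A i j| * (‖v‖ * ‖w‖) := by gcongr
    _ = _ := by ring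

open Matrix in
theorem exists_forall_dotProduct_mulVec_le_neg_mul_sq {ι : Type*} [Fintype ι] (A : Matrix ι ι ℝ)
    (N : Submodule ℝ (ι → ℝ)) (hN : ∀ v ∈ N, v ≠ 0 → v ⬝ᵥ A *ᵥ v < 0) :
    ∃ α > 0, ∀ v ∈ N, v ⬝ᵥ A *ᵥ v ≤ -α * ‖v‖ ^ 2 := by
  have hcomp : IsCompact ((N : Set (ι → ℝ)) ∩ Metric.sphere 0 1) :=
    (isCompact_sphere _ _).inter_left N.closed_of_finiteDimensional
  have hunit : ∀ v ∈ N, v ≠ 0 → ‖v‖⁻¹ • v ∈ (N : Set (ι → ℝ)) ∩ Metric.sphere 0 1 := by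
    intro v hv hv0
    refine ⟨N.smul_mem _ hv, ?_⟩
    simp [norm_smul, norm_ne_zero_iff.2 hv0]
  by_cases hne : ((N : Set (ι → ℝ)) ∩ Metric.sphere 0 1).Nonempty
  · obtain ⟨u, hu, hmax⟩ := hcomp.exists_isMaxOn hne (f := fun v => v ⬝ᵥ A *ᵥ v)
      (by fun_prop)
    have hu0 : u ≠ 0 := by
      rintro rfl
      simp at hu
    refine ⟨-(u ⬝ᵥ A *ᵥ u), by linarith [hN u hu.1 hu0], fun v hv => ?_⟩
    by_cases hv0 : v = 0
    · simp [hv0]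
    have h := hmax (hunit v hv hv0)
    simp only [mulVec_smul, dotProduct_smul, smul_dotProduct, smul_eq_mul, Set.mem_ofPred_eq] at h
    have hpos : 0 < ‖v‖ := norm_pos_iff.2 hv0
    rw [neg_neg]
    calc v ⬝ᵥ A *ᵥ v = (‖v‖⁻¹ * (‖v‖⁻¹ * v ⬝ᵥ A *ᵥ v)) * ‖v‖ ^ 2 := by field_simp
      _ ≤ _ := by gcongr
  · refine ⟨1, one_pos, fun v hv => ?_⟩
    by_cases hv0 : v = 0
    · simp [hv0]
    · exact absurd ⟨_, hunit v hv hv0⟩ hne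

open Matrix Filter Topology in
theorem eventually_neg_of_neg_of_deriv_neg {ι : Type*} [Fintype ι] (A₀ A₁ : Matrix ι ι ℝ)
    (R : ℝ → Matrix ι ι ℝ) (M : ℝ) (hA₀ : A₀.IsSymm) (hA₁ : A₁.IsSymm)
    (hR : ∀ δ ∈ Set.Ioo (0 : ℝ) 1, ∀ i j, |R δ i j| ≤ M)
    (N K : Submodule ℝ (ι → ℝ)) (hN : ∀ v ∈ N, v ≠ 0 → v ⬝ᵥ A₀ *ᵥ v < 0)
    (hK : ∀ v ∈ K, A₀ *ᵥ v = 0) (hK₁ : ∀ v ∈ K, v ≠ 0 → v ⬝ᵥ A₁ *ᵥ v < 0) :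
    ∀ᶠ δ in 𝓝[>] (0 : ℝ), ∀ v ∈ N ⊔ K, v ≠ 0 →
      v ⬝ᵥ (A₀ + δ • A₁ + δ ^ 2 • R δ) *ᵥ v < 0 := by
  obtain ⟨α, hα, hαN⟩ := exists_forall_dotProduct_mulVec_le_neg_mul_sq A₀ N hN
  obtain ⟨γ, hγ, hγK⟩ := exists_forall_dotProduct_mulVec_le_neg_mul_sq A₁ K hK₁
  set C₁ : ℝ := ∑ i, ∑ j, |A₁ i j| with hC₁
  set C₂ : ℝ := ∑ _i : ι, ∑ _j : ι, |M| with hC₂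
  have hC₁0 : 0 ≤ C₁ := Finset.sum_nonneg fun i _ => Finset.sum_nonneg fun j _ => abs_nonneg _
  have hC₂0 : 0 ≤ C₂ := Finset.sum_nonneg fun i _ => Finset.sum_nonneg fun j _ => abs_nonneg _
  have hlim₁ : ∀ᶠ δ in 𝓝[>] (0 : ℝ), -α + δ * C₁ + δ * (2 * C₁ ^ 2 / γ) + 2 * δ ^ 2 * C₂ < 0 := by
    have : Tendsto (fun δ : ℝ => -α + δ * C₁ + δ * (2 * C₁ ^ 2 / γ) + 2 * δ ^ 2 * C₂) (𝓝[>] 0)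
        (𝓝 (-α + 0 * C₁ + 0 * (2 * C₁ ^ 2 / γ) + 2 * 0 ^ 2 * C₂)) :=
      tendsto_nhdsWithin_of_tendsto_nhds (Continuous.tendsto (by fun_prop) 0)
    exact this.eventually_lt_const (by simpa using hα)
  have hlim₂ : ∀ᶠ δ in 𝓝[>] (0 : ℝ), -γ / 2 + 2 * δ * C₂ < 0 := by
    have : Tendsto (fun δ : ℝ => -γ / 2 + 2 * δ * C₂) (𝓝[>] 0) (𝓝 (-γ / 2 + 2 * 0 * C₂)) :=
      tendsto_nhdsWithin_of_tendsto_nhds (Continuous.tendsto (by fun_prop) 0)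
    exact this.eventually_lt_const (by simp; linarith)
  filter_upwards [hlim₁, hlim₂, Ioo_mem_nhdsGT one_pos] with δ h₁ h₂ hδ v hv hv0
  obtain ⟨a, ha, u, hu, rfl⟩ := Submodule.mem_sup.1 hv
  have hδ0 : 0 < δ := hδ.1
  have e0 : (a + u) ⬝ᵥ A₀ *ᵥ (a + u) = a ⬝ᵥ A₀ *ᵥ a := by
    have : u ⬝ᵥ A₀ *ᵥ a = 0 := by
      rw [dotProduct_mulVec, ← mulVec_transpose, hA₀, hK u hu, zero_dotProduct]
    rw [mulVec_add, hK u hu, add_zero, add_dotProduct, this, add_zero]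
  have e1 : (a + u) ⬝ᵥ A₁ *ᵥ (a + u) = a ⬝ᵥ A₁ *ᵥ a + 2 * a ⬝ᵥ A₁ *ᵥ u + u ⬝ᵥ A₁ *ᵥ u := by
    have : u ⬝ᵥ A₁ *ᵥ a = a ⬝ᵥ A₁ *ᵥ u := by
      rw [dotProduct_mulVec, ← mulVec_transpose, hA₁, dotProduct_comm]
    simp only [mulVec_add, add_dotProduct, dotProduct_add, this]
    ring
  have b0 := hαN a ha
  have b1 : a ⬝ᵥ A₁ *ᵥ a ≤ C₁ * ‖a‖ * ‖a‖ := (le_abs_self _).trans (abs_dotProduct_mulVec_le _ _ _)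
  have b2 : a ⬝ᵥ A₁ *ᵥ u ≤ C₁ * ‖a‖ * ‖u‖ := (le_abs_self _).trans (abs_dotProduct_mulVec_le _ _ _)
  have b3 := hγK u hu
  have b4 : (a + u) ⬝ᵥ R δ *ᵥ (a + u) ≤ C₂ * (‖a‖ + ‖u‖) * (‖a‖ + ‖u‖) := by
    refine (le_abs_self _).trans ((abs_dotProduct_mulVec_le _ _ _).trans ?_)
    have : ∑ i, ∑ j, |R δ i j| ≤ C₂ :=
      Finset.sum_le_sum fun i _ => Finset.sum_le_sum fun j _ => (hR δ hδ i j).trans (le_abs_self _)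
    gcongr <;> exact norm_add_le _ _
  have hnorm : 0 < ‖a‖ ^ 2 ∨ 0 < ‖u‖ ^ 2 := by
    by_contra! h
    have h1 : ‖a‖ = 0 := by nlinarith [norm_nonneg a]
    have h2 : ‖u‖ = 0 := by nlinarith [norm_nonneg u]
    rw [norm_eq_zero] at h1 h2
    simp [h1, h2] at hv0
  rw [add_mulVec, add_mulVec, dotProduct_add, dotProduct_add, smul_mulVec, smul_mulVec,
    dotProduct_smul, dotProduct_smul, e0, e1, smul_eq_mul, smul_eq_mul]
  generalize ‖a‖ = s at *
  generalize ‖u‖ = t at *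
  have hst : 2 * (C₁ * s * t) ≤ (2 * C₁ ^ 2 / γ) * s ^ 2 + γ / 2 * t ^ 2 := by
    have : 0 ≤ (2 * C₁ * s - γ * t) ^ 2 / (2 * γ) := by positivity
    have e : (2 * C₁ * s - γ * t) ^ 2 / (2 * γ) =
      (2 * C₁ ^ 2 / γ) * s ^ 2 + γ / 2 * t ^ 2 - 2 * (C₁ * s * t) := by
      field_simp
      ring
    linarith
  have hst2 : C₂ * (s + t) * (s + t) ≤ C₂ * (2 * s ^ 2 + 2 * t ^ 2) := by
    have : (s + t) * (s + t) ≤ 2 * s ^ 2 + 2 * t ^ 2 := by nlinarith [sq_nonneg (s - t)]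
    calc C₂ * (s + t) * (s + t) = C₂ * ((s + t) * (s + t)) := by ring
      _ ≤ _ := by gcongr
  have f1 := mul_le_mul_of_nonneg_left (add_le_add (add_le_add b1
    (mul_le_mul_of_nonneg_left b2 zero_le_two)) b3) hδ0.le
  have f2 := mul_le_mul_of_nonneg_left (b4.trans hst2) (sq_nonneg δ)
  have f3 := mul_le_mul_of_nonneg_left hst hδ0.le
  have key : -α * s ^ 2 + δ * (C₁ * s * s + 2 * (C₁ * s * t) + -γ * t ^ 2) +
      δ ^ 2 * (C₂ * (2 * s ^ 2 + 2 * t ^ 2)) ≤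
      (-α + δ * C₁ + δ * (2 * C₁ ^ 2 / γ) + 2 * δ ^ 2 * C₂) * s ^ 2 +
        δ * (-γ / 2 + 2 * δ * C₂) * t ^ 2 := by
    linarith
  refine lt_of_le_of_lt (by linarith) (lt_of_le_of_lt key ?_)
  have g : δ * (-γ / 2 + 2 * δ * C₂) < 0 := mul_neg_of_pos_of_neg hδ0 h₂
  rcases hnorm with h | h
  · nlinarith [mul_nonneg_of_nonpos_of_nonpos g.le (neg_nonpos.2 (sq_nonneg t)),
      mul_pos_of_neg_of_neg h₁ (neg_lt_zero.2 h)]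
  · nlinarith [mul_nonneg_of_nonpos_of_nonpos h₁.le (neg_nonpos.2 (sq_nonneg s)),
      mul_pos_of_neg_of_neg g (neg_lt_zero.2 h)]

theorem Matrix.pow_sum_add_sum_dvd_det {ι R : Type*} [Fintype ι] [DecidableEq ι] [CommRing R]
    (G : Matrix ι ι R) (δ : R) (a b : ι → ℕ) (h : ∀ i j, δ ^ (a i + b j) ∣ G i j) :
    δ ^ (∑ i, a i + ∑ i, b i) ∣ G.det := by
  rw [Matrix.det_apply]
  refine Finset.dvd_sum fun σ _ => ?_
  rw [Units.smul_def, zsmul_eq_mul]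
  refine Dvd.dvd.mul_left ?_ _
  have : ∑ i, a i + ∑ i, b i = ∑ i, (a (σ i) + b i) := by
    rw [Finset.sum_add_distrib, Equiv.sum_comp σ a]
  rw [this, ← Finset.prod_pow_eq_pow_sum]
  exact Finset.prod_dvd_prod_of_dvd _ _ fun i _ => h (σ i) i

theorem Polynomial.X_sub_C_sq_dvd_of_eval_eq_zero {p : Polynomial ℝ} {x₀ : ℝ} (h₀ : p.eval x₀ = 0)
    (h₁ : p.derivative.eval x₀ = 0) : (Polynomial.X - Polynomial.C x₀) ^ 2 ∣ p := by
  obtain ⟨q, rfl⟩ := Polynomial.dvd_iff_isRoot.2 h₀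
  rw [sq]
  refine mul_dvd_mul_left _ (Polynomial.dvd_iff_isRoot.2 ?_)
  simpa [Polynomial.IsRoot] using h₁

open Matrix in
theorem Polynomial.eval_C_dotProduct_mulVec {ι : Type*} [Fintype ι] (H : Matrix ι ι (Polynomial ℝ))
    (x : ℝ) (u v : ι → ℝ) :
    ((fun i => Polynomial.C (u i)) ⬝ᵥ H *ᵥ (fun i => Polynomial.C (v i))).eval x =
      u ⬝ᵥ (H.map (Polynomial.eval x)) *ᵥ v := by
  simp [dotProduct, mulVec, Polynomial.eval_finsetSum]

open Matrix in
theorem Polynomial.eval_derivative_C_dotProduct_mulVec {ι : Type*} [Fintype ι]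
    (H : Matrix ι ι (Polynomial ℝ)) (x : ℝ) (u v : ι → ℝ) :
    ((fun i => Polynomial.C (u i)) ⬝ᵥ H *ᵥ (fun i => Polynomial.C (v i))).derivative.eval x =
      u ⬝ᵥ (H.map fun p => p.derivative.eval x) *ᵥ v := by
  simp [dotProduct, mulVec, Polynomial.eval_finsetSum]

open Matrix in
theorem Polynomial.pow_dvd_det_of_kernel {n c : ℕ} (H : Matrix (Fin n) (Fin n) (Polynomial ℝ))
    (hH : H.IsSymm) (x₀ : ℝ) (v : Fin c → Fin n → ℝ) (hv : LinearIndependent ℝ v)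
    (hker : ∀ i, (H.map (Polynomial.eval x₀)) *ᵥ v i = 0) (J : Finset (Fin c))
    (hJ : ∀ i ∈ J, ∀ j, v i ⬝ᵥ (H.map fun p => p.derivative.eval x₀) *ᵥ v j = 0) :
    (Polynomial.X - Polynomial.C x₀) ^ (c + J.card) ∣ H.det := by
  classical
  set b' := Module.Basis.sumExtend hv
  have hfin : Finite (Fin c ⊕ ↑(Module.Basis.sumExtendIndex hv)) := Module.Finite.finite_basis b'
  have : Finite (Module.Basis.sumExtendIndex hv) := Finite.of_injective Sum.inr
    (Sum.inr_injective (α := Fin c))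
  have : Fintype (Module.Basis.sumExtendIndex hv) := Fintype.ofFinite _
  let e := b'.indexEquiv (Pi.basisFun ℝ (Fin n))
  let b : Module.Basis (Fin n) ℝ (Fin n → ℝ) := b'.reindex e
  have hb : ∀ i : Fin c, b (e (Sum.inl i)) = v i := by
    intro i
    simp only [b, b', Module.Basis.sumExtend, Module.Basis.reindex_apply, Equiv.symm_apply_apply,
      Module.Basis.extend_apply_self]
    rfl
  let B : Matrix (Fin n) (Fin n) ℝ := (Pi.basisFun ℝ (Fin n)).toMatrix b
  have hB : IsUnit B.det := by
    have := (Pi.basisFun ℝ (Fin n)).isUnit_det b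
    rwa [Module.Basis.det_apply] at this
  let G : Matrix (Fin n) (Fin n) (Polynomial ℝ) := (B.map Polynomial.C)ᵀ * H * B.map Polynomial.C
  have hGdet : G.det = Polynomial.C (B.det ^ 2) * H.det := by
    have : (B.map Polynomial.C).det = Polynomial.C B.det := (RingHom.map_det Polynomial.C B).symm
    simp only [G, Matrix.det_mul, Matrix.det_transpose, this, Polynomial.C_pow]
    ring
  have hG : ∀ i j, G i j =
      (fun k => Polynomial.C (b i k)) ⬝ᵥ H *ᵥ (fun k => Polynomial.C (b j k)) := by
    intro i j
    simp only [G, Matrix.mul_assoc]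
    rw [Matrix.mul_apply]
    rfl
  have hGsymm : ∀ i j, G i j = G j i := by
    intro i j
    rw [hG, hG, dotProduct_mulVec, ← mulVec_transpose, hH, dotProduct_comm]
  let bb : Fin n → ℕ := fun i => Sum.elim (fun _ => 1) (fun _ => 0) (e.symm i)
  let aa : Fin n → ℕ := fun i => Sum.elim (fun k => if k ∈ J then 1 else 0) (fun _ => 0) (e.symm i)
  have hdvd1 : ∀ i k, (Polynomial.X - Polynomial.C x₀) ∣ G i (e (Sum.inl k)) := by
    intro i k
    rw [Polynomial.dvd_iff_isRoot, Polynomial.IsRoot, hG, Polynomial.eval_C_dotProduct_mulVec]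
    simp [hb, hker]
  have hdvd2 : ∀ i ∈ J, ∀ j, (Polynomial.X - Polynomial.C x₀) ^ 2 ∣
      G (e (Sum.inl i)) (e (Sum.inl j)) := by
    intro i hi j
    refine Polynomial.X_sub_C_sq_dvd_of_eval_eq_zero ?_ ?_
    · exact Polynomial.dvd_iff_isRoot.1 (hdvd1 _ _)
    · rw [hG, Polynomial.eval_derivative_C_dotProduct_mulVec]
      simp only [hb]
      exact hJ i hi j
  have key := Matrix.pow_sum_add_sum_dvd_det G (Polynomial.X - Polynomial.C x₀) aa bb (by
    intro i j
    obtain ⟨i, rfl⟩ := e.surjective i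
    obtain ⟨j, rfl⟩ := e.surjective j
    rcases i with i | i <;> rcases j with j | j <;>
      simp only [aa, bb, Equiv.symm_apply_apply, Sum.elim_inl, Sum.elim_inr]
    · split_ifs with hi
      · exact hdvd2 i hi j
      · simpa using hdvd1 _ j
    · split_ifs with hi
      · rw [hGsymm]
        simpa using hdvd1 _ i
      · simp
    · simpa using hdvd1 _ j
    · simp)
  have hs1 : ∑ i, aa i = J.card := by
    rw [← Equiv.sum_comp e]
    simp [aa, Fintype.sum_sum_type]
  have hs2 : ∑ i, bb i = c := by
    rw [← Equiv.sum_comp e]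
    simp [bb, Fintype.sum_sum_type]
  rw [hs1, hs2, add_comm, hGdet] at key
  exact (IsUnit.dvd_mul_left (Polynomial.isUnit_C.2 (hB.pow 2))).1 key

theorem Polynomial.exists_eq_taylor_two (p : Polynomial ℝ) (x₀ : ℝ) :
    ∃ q : Polynomial ℝ, ∀ x, p.eval x = p.eval x₀ + (x - x₀) * p.derivative.eval x₀ +
      (x - x₀) ^ 2 * q.eval x := by
  obtain ⟨q, hq⟩ := Polynomial.X_sub_C_sq_dvd_of_eval_eq_zero (x₀ := x₀)
    (p := p - Polynomial.C (p.eval x₀) -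
      (Polynomial.X - Polynomial.C x₀) * Polynomial.C (p.derivative.eval x₀))
    (by simp) (by simp)
  refine ⟨q, fun x => ?_⟩
  have := congrArg (Polynomial.eval x) hq
  simp at this
  linarith

open Matrix in
theorem dotProduct_mulVec_sum_smul {ι κ : Type*} [Fintype ι] [Fintype κ] (A : Matrix ι ι ℝ)
    (v : κ → ι → ℝ) (hv : ∀ i j, i ≠ j → v i ⬝ᵥ A *ᵥ v j = 0) (a : κ → ℝ) :
    (∑ i, a i • v i) ⬝ᵥ A *ᵥ (∑ i, a i • v i) = ∑ i, a i ^ 2 * (v i ⬝ᵥ A *ᵥ v i) := by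
  classical
  simp only [sum_dotProduct, mulVec_sum, dotProduct_sum, mulVec_smul, dotProduct_smul,
    smul_dotProduct, smul_eq_mul]
  refine Finset.sum_congr rfl fun i _ => ?_
  rw [Finset.sum_eq_single i]
  · ring
  · intro j _ hj
    rw [hv j i hj]
    simp
  · simp

open Matrix in
theorem finrank_span_and_neg_of_orthogonal {ι : Type*} [Fintype ι] {c : ℕ} (A : Matrix ι ι ℝ)
    (v : Fin c → ι → ℝ) (hv : LinearIndependent ℝ v)
    (horth : ∀ i j, i ≠ j → v i ⬝ᵥ A *ᵥ v j = 0) (J : Finset (Fin c))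
    (hJ : ∀ i ∈ J, v i ⬝ᵥ A *ᵥ v i < 0) :
    Module.finrank ℝ (Submodule.span ℝ (v '' (J : Set (Fin c)))) = J.card ∧
      ∀ u ∈ Submodule.span ℝ (v '' (J : Set (Fin c))), u ≠ 0 → u ⬝ᵥ A *ᵥ u < 0 := by
  have hvJ : LinearIndependent ℝ fun i : J => v i := hv.comp _ Subtype.val_injective
  have hrange : v '' (J : Set (Fin c)) = Set.range fun i : J => v i := by
    ext
    simp
  rw [hrange]
  refine ⟨by simpa using finrank_span_eq_card hvJ, fun u hu hu0 => ?_⟩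
  obtain ⟨a, rfl⟩ := (Submodule.mem_span_range_iff_exists_fun ℝ).1 hu
  rw [dotProduct_mulVec_sum_smul A (fun i : J => v i)
    (fun i j hij => horth i j (Subtype.coe_injective.ne hij))]
  have hne : ∃ i, a i ≠ 0 := by
    by_contra! h
    simp [h] at hu0
  obtain ⟨i, hi⟩ := hne
  refine Finset.sum_neg' (fun j _ => ?_) ⟨i, Finset.mem_univ _, ?_⟩
  · exact mul_nonpos_of_nonneg_of_nonpos (sq_nonneg _) (hJ j j.2).le
  · exact mul_neg_of_pos_of_neg (by positivity) (hJ i i.2)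

open Matrix Filter Topology in
/-- Let `H` be a symmetric polynomial matrix and let `L` be a subspace on which the quadratic form
of `H(x₀)` is nonpositive and vanishes only on the kernel. The negative directions of `H` just to
the right and just to the left of `x₀` together account for `2 dim L`, up to the multiplicity of
`x₀` as a root of `det H`. -/
theorem exists_negative_subspaces_near {n : ℕ} (H : Matrix (Fin n) (Fin n) (Polynomial ℝ))
    (hH : H.IsSymm) (hdet : H.det ≠ 0) (x₀ : ℝ) (L : Submodule ℝ (Fin n → ℝ))
    (hL : ∀ v ∈ L, v ⬝ᵥ (H.map (Polynomial.eval x₀)) *ᵥ v ≤ 0)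
    (hL₀ : ∀ v ∈ L, v ⬝ᵥ (H.map (Polynomial.eval x₀)) *ᵥ v = 0 →
      (H.map (Polynomial.eval x₀)) *ᵥ v = 0) :
    ∃ N₁ N₂ : Submodule ℝ (Fin n → ℝ),
      2 * Module.finrank ℝ L ≤
        Module.finrank ℝ N₁ + Module.finrank ℝ N₂ + H.det.rootMultiplicity x₀ ∧
      (∀ᶠ x in 𝓝[>] x₀, ∀ v ∈ N₁, v ≠ 0 → v ⬝ᵥ (H.map (Polynomial.eval x)) *ᵥ v < 0) ∧
      (∀ᶠ x in 𝓝[<] x₀, ∀ v ∈ N₂, v ≠ 0 → v ⬝ᵥ (H.map (Polynomial.eval x)) *ᵥ v < 0) := by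
  set A₀ : Matrix (Fin n) (Fin n) ℝ := H.map (Polynomial.eval x₀) with hA₀
  set A₁ : Matrix (Fin n) (Fin n) ℝ := H.map (fun p => p.derivative.eval x₀) with hA₁
  have hs₀ : A₀.IsSymm := by
    rw [hA₀]; exact hH.map _
  have hs₁ : A₁.IsSymm := by
    rw [hA₁]; exact hH.map _
  -- a Taylor expansion with bounded remainder
  choose q hq using fun i j => Polynomial.exists_eq_taylor_two (H i j) x₀
  obtain ⟨M, hM⟩ : ∃ M : ℝ, ∀ δ ∈ Set.Icc (-1 : ℝ) 1, ∀ i j, |(q i j).eval (x₀ + δ)| ≤ M := by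
    have hc : ContinuousOn (fun δ : ℝ => ∑ i, ∑ j, |(q i j).eval (x₀ + δ)|) (Set.Icc (-1) 1) :=
      Continuous.continuousOn (by fun_prop)
    obtain ⟨M, hM⟩ := isCompact_Icc.bddAbove_image hc
    refine ⟨M, fun δ hδ i j => le_trans ?_ (hM ⟨δ, hδ, rfl⟩)⟩
    refine le_trans ?_ (Finset.single_le_sum (f := fun i => ∑ j, |(q i j).eval (x₀ + δ)|)
      (fun i _ => Finset.sum_nonneg fun j _ => abs_nonneg _) (Finset.mem_univ i))
    exact Finset.single_le_sum (f := fun j => |(q i j).eval (x₀ + δ)|)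
      (fun j _ => abs_nonneg _) (Finset.mem_univ j)
  -- the kernel part and a negative definite complement
  let K : Submodule ℝ (Fin n → ℝ) := L ⊓ LinearMap.ker A₀.mulVecLin
  obtain ⟨K', hK'⟩ := Submodule.exists_isCompl K
  let N : Submodule ℝ (Fin n → ℝ) := K' ⊓ L
  have hKL : K ≤ L := inf_le_left
  have hKker : ∀ v ∈ K, A₀ *ᵥ v = 0 := fun v hv => by simpa using hv.2
  have hsup : K ⊔ N = L := by
    simp only [N]
    rw [← sup_inf_assoc_of_le K' hKL, hK'.sup_eq_top, top_inf_eq]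
  have hinf : K ⊓ N = ⊥ := by
    simp only [N]
    rw [← inf_assoc, hK'.inf_eq_bot, bot_inf_eq]
  have hdimL : Module.finrank ℝ K + Module.finrank ℝ N = Module.finrank ℝ L := by
    have := Submodule.finrank_sup_add_finrank_inf_eq K N
    rw [hsup, hinf, finrank_bot] at this
    omega
  have hNneg : ∀ v ∈ N, v ≠ 0 → v ⬝ᵥ A₀ *ᵥ v < 0 := by
    intro v hv hv0
    refine lt_of_le_of_ne (hL v hv.2) fun h => hv0 ?_
    have : v ∈ K ⊓ N := ⟨⟨hv.2, by simpa using hL₀ v hv.2 h⟩, hv⟩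
    simpa [hinf] using this
  -- diagonalise the first order term on the kernel
  let β : LinearMap.BilinForm ℝ K := (Matrix.toBilin' A₁).restrict K
  have hβ : ∀ u v : K, β u v = (u : Fin n → ℝ) ⬝ᵥ A₁ *ᵥ (v : Fin n → ℝ) := fun u v => by
    simp [β, Matrix.toBilin'_apply']
  have hβs : LinearMap.IsSymm β := by
    refine ⟨fun u v => ?_⟩
    simp only [RingHom.id_apply, hβ]
    rw [dotProduct_mulVec, ← mulVec_transpose, hs₁, dotProduct_comm]
  obtain ⟨w, hw⟩ := LinearMap.BilinForm.exists_orthogonal_basis hβs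
  let v : Fin (Module.finrank ℝ K) → Fin n → ℝ := fun i => w i
  have hv : LinearIndependent ℝ v := w.linearIndependent.map' K.subtype K.ker_subtype
  have hvK : ∀ i, v i ∈ K := fun i => (w i).2
  have horth : ∀ i j, i ≠ j → v i ⬝ᵥ A₁ *ᵥ v j = 0 := fun i j hij => by
    rw [← hβ]
    exact hw hij
  let Jn : Finset (Fin (Module.finrank ℝ K)) := {i | v i ⬝ᵥ A₁ *ᵥ v i < 0}
  let Jp : Finset (Fin (Module.finrank ℝ K)) := {i | 0 < v i ⬝ᵥ A₁ *ᵥ v i}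
  let Jz : Finset (Fin (Module.finrank ℝ K)) := {i | v i ⬝ᵥ A₁ *ᵥ v i = 0}
  have hcard : Jn.card + Jp.card + Jz.card = Module.finrank ℝ K := by
    have h1 : Disjoint Jn Jp := by
      simp only [Jn, Jp, Finset.disjoint_filter]
      intros; linarith
    have h2 : Disjoint (Jn ∪ Jp) Jz := by
      simp only [Jn, Jp, Jz, ← Finset.filter_or, Finset.disjoint_filter]
      intro i _ h h'
      rcases h with h | h <;> linarith
    rw [← Finset.card_union_of_disjoint h1, ← Finset.card_union_of_disjoint h2]
    have : Jn ∪ Jp ∪ Jz = Finset.univ := by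
      ext i
      simp only [Jn, Jp, Jz, Finset.mem_union, Finset.mem_filter, Finset.mem_univ, true_and,
        iff_true]
      rcases lt_trichotomy (v i ⬝ᵥ A₁ *ᵥ v i) 0 with h | h | h <;> simp [h]
    rw [this, Finset.card_univ, Fintype.card_fin]
  have hmult : Module.finrank ℝ K + Jz.card ≤ H.det.rootMultiplicity x₀ := by
    rw [Polynomial.le_rootMultiplicity_iff hdet]
    refine Polynomial.pow_dvd_det_of_kernel H hH x₀ v hv (fun i => hKker _ (hvK i)) Jz ?_
    intro i hi j
    by_cases hij : i = j
    · subst hij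
      simpa [Jz] using hi
    · exact horth i j hij
  obtain ⟨hn₁, hn₂⟩ := finrank_span_and_neg_of_orthogonal A₁ v hv horth Jn (by simp [Jn])
  obtain ⟨hp₁, hp₂⟩ := finrank_span_and_neg_of_orthogonal (-A₁) v hv
    (fun i j hij => by simp [neg_mulVec, horth i j hij]) Jp (by simp [Jp, neg_mulVec])
  have hspan : ∀ J : Finset (Fin (Module.finrank ℝ K)),
      Submodule.span ℝ (v '' (J : Set (Fin (Module.finrank ℝ K)))) ≤ K := by
    intro J
    rw [Submodule.span_le]
    rintro _ ⟨i, _, rfl⟩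
    exact hvK i
  have hdim : ∀ J : Finset (Fin (Module.finrank ℝ K)),
      Module.finrank ℝ ↥(N ⊔ Submodule.span ℝ (v '' (J : Set (Fin (Module.finrank ℝ K))))) =
        Module.finrank ℝ N +
          Module.finrank ℝ (Submodule.span ℝ (v '' (J : Set (Fin (Module.finrank ℝ K))))) := by
    intro J
    have := Submodule.finrank_sup_add_finrank_inf_eq N
      (Submodule.span ℝ (v '' (J : Set (Fin (Module.finrank ℝ K)))))
    have hbot : N ⊓ Submodule.span ℝ (v '' (J : Set (Fin (Module.finrank ℝ K)))) = ⊥ := by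
      rw [eq_bot_iff, ← hinf, inf_comm K N]
      exact inf_le_inf_left N (hspan J)
    rw [hbot, finrank_bot] at this
    omega
  refine ⟨N ⊔ Submodule.span ℝ (v '' (Jn : Set _)), N ⊔ Submodule.span ℝ (v '' (Jp : Set _)),
    ?_, ?_, ?_⟩
  · rw [hdim, hdim, hn₁, hp₁]
    omega
  · have ht : Tendsto (fun x => x - x₀) (𝓝[>] x₀) (𝓝[>] 0) := by
      refine tendsto_nhdsWithin_of_tendsto_nhds_of_eventually_within _ ?_ ?_
      · exact tendsto_nhdsWithin_of_tendsto_nhds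
          (by simpa using (continuous_sub_right x₀).tendsto x₀)
      · filter_upwards [self_mem_nhdsWithin] with x hx
        simpa using hx
    have := ht.eventually (eventually_neg_of_neg_of_deriv_neg A₀ A₁
      (fun δ => Matrix.of fun i j => (q i j).eval (x₀ + δ)) M hs₀ hs₁
      (fun δ hδ i j => hM δ ⟨by linarith [hδ.1], hδ.2.le⟩ i j) N _ hNneg
      (fun v hv => hKker v (hspan Jn hv)) hn₂)
    filter_upwards [this] with x hx
    convert hx using 6
    ext i j
    simp [hq i j x, A₀, A₁]
  · have ht : Tendsto (fun x => x₀ - x) (𝓝[<] x₀) (𝓝[>] 0) := by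
      refine tendsto_nhdsWithin_of_tendsto_nhds_of_eventually_within _ ?_ ?_
      · exact tendsto_nhdsWithin_of_tendsto_nhds
          (by simpa using (continuous_sub_left x₀).tendsto x₀)
      · filter_upwards [self_mem_nhdsWithin] with x hx
        simpa using hx
    have := ht.eventually (eventually_neg_of_neg_of_deriv_neg A₀ (-A₁)
      (fun δ => Matrix.of fun i j => (q i j).eval (x₀ + -δ)) M hs₀ hs₁.neg
      (fun δ hδ i j => hM (-δ) ⟨by linarith [hδ.2], by linarith [hδ.1]⟩ i j) N _ hNneg
      (fun v hv => hKker v (hspan Jp hv)) hp₂)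
    filter_upwards [this] with x hx
    convert hx using 6
    ext i j
    simp [hq i j x, A₀, A₁]
    ring

theorem Multiset.exists_fin_map_eq {α : Type*} (s : Multiset α) {n : ℕ} (hs : s.card = n) :
    ∃ f : Fin n → α, (Finset.univ : Finset (Fin n)).val.map f = s := by
  subst hs
  induction s using Quotient.inductionOn with
  | h l =>
    refine ⟨l.get, ?_⟩
    change Multiset.map l.get ((List.finRange l.length : List _) : Multiset _) = _
    rw [Multiset.map_coe, ← List.ofFn_eq_map, List.ofFn_get]
    rfl

/-- Newton's identities for the power sums of a multiset. -/
theorem Multiset.sum_map_pow_eq_newton {R : Type*} [CommRing R] (s : Multiset R) {k : ℕ}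
    (hk : 0 < k) :
    (s.map (· ^ k)).sum = (-1) ^ (k + 1) * k * s.esymm k -
      ∑ a ∈ Finset.HasAntidiagonal.antidiagonal k with a.1 ∈ Set.Ioo 0 k,
        (-1) ^ a.1 * s.esymm a.1 * (s.map (· ^ a.2)).sum := by
  obtain ⟨f, hf⟩ := s.exists_fin_map_eq rfl
  have h := congrArg (MvPolynomial.aeval f)
    (MvPolynomial.psum_eq_mul_esymm_sub_sum (Fin s.card) R k hk)
  have hp : ∀ m, MvPolynomial.aeval f (MvPolynomial.psum (Fin s.card) R m) =
      (s.map (· ^ m)).sum := by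
    intro m
    conv_rhs => rw [← hf, Multiset.map_map]
    rw [MvPolynomial.psum, map_sum]
    simp only [map_pow, MvPolynomial.aeval_X]
    rfl
  simp only [map_sub, map_mul, map_pow, map_neg, map_one, map_natCast, map_sum, hp,
    MvPolynomial.aeval_esymm_eq_multiset_esymm, hf] at h
  exact h

open Polynomial in
theorem Polynomial.exists_esymm_aroots_eq_eval (F : Polynomial (Polynomial ℝ)) (hF : F.Monic)
    (hdeg : ∀ j d, F.natDegree < j + d → (F.coeff j).coeff d = 0) (k : ℕ) :
    ∃ e : Polynomial ℝ, e.natDegree ≤ k ∧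
      ∀ x, ((F.map (evalRingHom x)).aroots ℂ).esymm k = ((e.eval x : ℝ) : ℂ) := by
  have hmonic : ∀ x, (F.map (evalRingHom x)).Monic := fun x => hF.map _
  have hnat : ∀ x, (F.map (evalRingHom x)).natDegree = F.natDegree := fun x => hF.natDegree_map _
  have hcard : ∀ x, ((F.map (evalRingHom x)).aroots ℂ).card = F.natDegree := by
    intro x
    rw [← hnat x, ← natDegree_map (p := F.map (evalRingHom x)) (algebraMap ℝ ℂ)]
    exact splits_iff_card_roots.1 (IsAlgClosed.splits _)
  by_cases hk : k ≤ F.natDegree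
  · refine ⟨(-1) ^ k * F.coeff (F.natDegree - k), ?_, fun x => ?_⟩
    · refine natDegree_mul_le.trans ?_
      have h1 : ((-1 : ℝ[X]) ^ k).natDegree = 0 := by
        have : ((-1 : ℝ[X]) ^ k) = C ((-1) ^ k) := by simp
        rw [this, natDegree_C]
      rw [h1, zero_add, natDegree_le_iff_coeff_eq_zero]
      exact fun d hd => hdeg _ _ (by omega)
    · have h := coeff_eq_esymm_roots_of_card (p := (F.map (evalRingHom x)).map (algebraMap ℝ ℂ))
        (by rw [natDegree_map, hnat]; exact hcard x) (k := F.natDegree - k)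
        (by rw [natDegree_map, hnat]; omega)
      rw [((hmonic x).map _).leadingCoeff, natDegree_map, hnat, Nat.sub_sub_self hk, one_mul,
        coeff_map, coeff_map] at h
      have h2 : ((-1 : ℂ) ^ k) * (-1) ^ k = 1 := by
        rw [← mul_pow]; simp
      simp only [eval_mul, eval_pow, eval_neg, eval_one, Complex.ofReal_mul, Complex.ofReal_pow,
        Complex.ofReal_neg, Complex.ofReal_one]
      have h3 : (((F.coeff (F.natDegree - k)).eval x : ℝ) : ℂ) =
          (-1) ^ k * ((F.map (evalRingHom x)).aroots ℂ).esymm k := h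
      rw [h3, ← mul_assoc, h2, one_mul]
  · refine ⟨0, by simp, fun x => ?_⟩
    rw [Multiset.esymm, Multiset.powersetCard_eq_empty]
    · simp
    · rw [hcard]; omega

open Polynomial in
theorem Polynomial.exists_powerSum_aroots_eq_eval (F : Polynomial (Polynomial ℝ)) (hF : F.Monic)
    (hdeg : ∀ j d, F.natDegree < j + d → (F.coeff j).coeff d = 0) (k : ℕ) :
    ∃ P : Polynomial ℝ, P.natDegree ≤ k ∧
      ∀ x, (((F.map (evalRingHom x)).aroots ℂ).map (· ^ k)).sum = ((P.eval x : ℝ) : ℂ) := by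
  choose e he₁ he₂ using Polynomial.exists_esymm_aroots_eq_eval F hF hdeg
  induction k using Nat.strong_induction_on with
  | _ k ih =>
    rcases Nat.eq_zero_or_pos k with rfl | hk
    · refine ⟨C (F.natDegree : ℝ), by simp, fun x => ?_⟩
      have : ((F.map (evalRingHom x)).aroots ℂ).card = F.natDegree := by
        rw [← hF.natDegree_map (evalRingHom x),
          ← natDegree_map (p := F.map (evalRingHom x)) (algebraMap ℝ ℂ)]
        exact splits_iff_card_roots.1 (IsAlgClosed.splits _)
      simp [this]
    · choose! P hP₁ hP₂ using ih
      refine ⟨C ((-1 : ℝ) ^ (k + 1) * k) * e k -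
        ∑ a ∈ Finset.HasAntidiagonal.antidiagonal k with a.1 ∈ Set.Ioo 0 k,
          C ((-1 : ℝ) ^ a.1) * (e a.1 * P a.2), ?_, fun x => ?_⟩
      · refine (natDegree_sub_le _ _).trans (max_le ((natDegree_C_mul_le _ _).trans (he₁ k)) ?_)
        refine natDegree_sum_le_of_forall_le _ _ fun a ha => ?_
        simp only [Finset.mem_filter, Finset.HasAntidiagonal.mem_antidiagonal, Set.mem_Ioo] at ha
        refine (natDegree_C_mul_le _ _).trans (natDegree_mul_le.trans ?_)
        have := he₁ a.1
        have := hP₁ a.2 (by omega)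
        omega
      · rw [Multiset.sum_map_pow_eq_newton _ hk, he₂]
        simp only [eval_sub, eval_mul, eval_C, eval_finsetSum, Complex.ofReal_sub,
          Complex.ofReal_mul, Complex.ofReal_pow, Complex.ofReal_neg, Complex.ofReal_one,
          Complex.ofReal_natCast, Complex.ofReal_sum]
        congr 1
        refine Finset.sum_congr rfl fun a ha => ?_
        simp only [Finset.mem_filter, Finset.HasAntidiagonal.mem_antidiagonal, Set.mem_Ioo] at ha
        rw [he₂, hP₂ a.2 (by omega), mul_assoc]

/-- The value at `w : ℂ` of the real polynomial with coefficient vector `v`. -/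
noncomputable def polyValue {n : ℕ} (v : Fin n → ℝ) (w : ℂ) : ℂ := ∑ j, (v j : ℂ) * w ^ (j : ℕ)

theorem polyValue_conj {n : ℕ} (v : Fin n → ℝ) (w : ℂ) :
    polyValue v (starRingEnd ℂ w) = starRingEnd ℂ (polyValue v w) := by
  simp [polyValue]

theorem polyValue_ofReal_im {n : ℕ} (v : Fin n → ℝ) (y : ℝ) : (polyValue v y).im = 0 := by
  rw [← Complex.conj_eq_iff_im, ← polyValue_conj, Complex.conj_ofReal]

open Polynomial Matrix in
/-- The Hermite matrix of a monic polynomial in `y` whose coefficients are polynomials in `x`. -/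
theorem Polynomial.exists_hermite_matrix (F : Polynomial (Polynomial ℝ)) (hF : F.Monic)
    (hdeg : ∀ j d, F.natDegree < j + d → (F.coeff j).coeff d = 0) :
    ∃ H : Matrix (Fin F.natDegree) (Fin F.natDegree) (Polynomial ℝ),
      H.IsSymm ∧ H.det.natDegree ≤ F.natDegree * (F.natDegree - 1) ∧
      ∀ (x : ℝ) (v : Fin F.natDegree → ℝ) (i : Fin F.natDegree),
        (((H.map (eval x) *ᵥ v) i : ℝ) : ℂ) =
          (((F.map (evalRingHom x)).aroots ℂ).map fun w => w ^ (i : ℕ) * polyValue v w).sum := by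
  choose P hP₁ hP₂ using Polynomial.exists_powerSum_aroots_eq_eval F hF hdeg
  refine ⟨Matrix.of fun i j => P (i + j), ?_, ?_, fun x v i => ?_⟩
  · ext i j : 1
    simp [add_comm]
  · rw [Matrix.det_apply]
    refine natDegree_sum_le_of_forall_le _ _ fun σ _ => ?_
    rw [Units.smul_def]
    refine (natDegree_smul_le _ _).trans ((natDegree_prod_le _ _).trans ?_)
    calc ∑ i, (P (((σ i : Fin _) : ℕ) + i)).natDegree
        ≤ ∑ i, (((σ i : Fin F.natDegree) : ℕ) + i) := Finset.sum_le_sum fun i _ => hP₁ _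
      _ = F.natDegree * (F.natDegree - 1) := by
        rw [Finset.sum_add_distrib, Equiv.sum_comp σ fun i : Fin F.natDegree => (i : ℕ),
          Fin.sum_univ_eq_sum_range (fun i => i), ← mul_two, Finset.sum_range_id_mul_two]
  · simp only [mulVec, dotProduct, Matrix.map_apply, Matrix.of_apply, Complex.ofReal_sum,
      Complex.ofReal_mul, ← hP₂, polyValue, Finset.mul_sum, Multiset.sum_map_sum]
    refine Finset.sum_congr rfl fun j _ => ?_
    rw [← Multiset.sum_map_mul_right]
    refine congrArg _ (Multiset.map_congr rfl fun w _ => ?_)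
    ring

open Polynomial Matrix in
theorem Polynomial.dotProduct_hermite_eq_sum {n : ℕ} (A : Matrix (Fin n) (Fin n) ℝ)
    (s : Multiset ℂ) (hA : ∀ (v : Fin n → ℝ) (i : Fin n),
      (((A *ᵥ v) i : ℝ) : ℂ) = (s.map fun w => w ^ (i : ℕ) * polyValue v w).sum)
    (v : Fin n → ℝ) : ((v ⬝ᵥ A *ᵥ v : ℝ) : ℂ) = (s.map fun w => polyValue v w ^ 2).sum := by
  simp only [dotProduct, Complex.ofReal_sum, Complex.ofReal_mul, hA, ← Multiset.sum_map_mul_left]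
  rw [← Multiset.sum_map_sum]
  refine congrArg _ (Multiset.map_congr rfl fun w _ => ?_)
  rw [sq, polyValue, Finset.sum_mul]
  exact Finset.sum_congr rfl fun i _ => by ring

theorem Multiset.sum_map_eq_zero_iff_of_nonneg {α : Type*} (s : Multiset α) (f : α → ℝ)
    (hf : ∀ a ∈ s, 0 ≤ f a) : (s.map f).sum = 0 ↔ ∀ a ∈ s, f a = 0 := by
  induction s using Multiset.induction_on with
  | empty => simp
  | cons a s ih =>
    have h₁ := hf a (Multiset.mem_cons_self a s)
    have h₂ : ∀ b ∈ s, 0 ≤ f b := fun b hb => hf b (Multiset.mem_cons_of_mem hb)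
    have h₃ : 0 ≤ (s.map f).sum := Multiset.sum_nonneg (by simpa using h₂)
    rw [Multiset.map_cons, Multiset.sum_cons, Multiset.forall_mem_cons,
      add_eq_zero_iff_of_nonneg h₁ h₃, ih h₂]

/-- The distinct real roots of a real polynomial. -/
noncomputable def Polynomial.realRoots (p : Polynomial ℝ) : Finset ℝ := p.roots.toFinset

open Classical in
/-- The distinct complex roots of a real polynomial in the open upper half plane. -/
noncomputable def Polynomial.upperRoots (p : Polynomial ℝ) : Finset ℂ :=
  (p.aroots ℂ).toFinset.filter fun w => 0 < w.im

theorem Polynomial.mem_realRoots {p : Polynomial ℝ} (hp : p ≠ 0) {y : ℝ} :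
    y ∈ p.realRoots ↔ p.eval y = 0 := by
  simp [Polynomial.realRoots, hp]

theorem Polynomial.mem_upperRoots {p : Polynomial ℝ} (hp : p ≠ 0) {w : ℂ} :
    w ∈ p.upperRoots ↔ Polynomial.aeval w p = 0 ∧ 0 < w.im := by
  simp [Polynomial.upperRoots, hp]

theorem Polynomial.aeval_conj_eq_zero {p : Polynomial ℝ} {w : ℂ} (h : Polynomial.aeval w p = 0) :
    Polynomial.aeval (starRingEnd ℂ w) p = 0 := by
  rw [Polynomial.aeval_conj, h, map_zero]

theorem Polynomial.aeval_ofReal_eq_zero_iff {p : Polynomial ℝ} {y : ℝ} :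
    Polynomial.aeval (y : ℂ) p = 0 ↔ p.eval y = 0 := by
  rw [← Complex.coe_algebraMap, Polynomial.aeval_algebraMap_apply, Complex.coe_algebraMap,
    Complex.ofReal_eq_zero, Polynomial.coe_aeval_eq_eval]

/-- A property of roots holds for all complex roots if it holds for the real roots, the roots in
the upper half plane, and is invariant under conjugation. -/
theorem Polynomial.forall_mem_aroots_of_upper {p : Polynomial ℝ} (hp : p ≠ 0) {P : ℂ → Prop}
    (hr : ∀ y ∈ p.realRoots, P (y : ℂ)) (hu : ∀ w ∈ p.upperRoots, P w)
    (hc : ∀ w, P w → P (starRingEnd ℂ w)) : ∀ w ∈ p.aroots ℂ, P w := by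
  intro w hw
  have hw0 : Polynomial.aeval w p = 0 := (Polynomial.mem_aroots.1 hw).2
  rcases lt_trichotomy w.im 0 with h | h | h
  · have := hc _ (hu (starRingEnd ℂ w) ((Polynomial.mem_upperRoots hp).2
      ⟨Polynomial.aeval_conj_eq_zero hw0, by simpa using h⟩))
    simpa using this
  · have hwr : ((w.re : ℝ) : ℂ) = w := Complex.ext (by simp) (by simp [h])
    rw [← hwr] at hw0 ⊢
    exact hr _ ((Polynomial.mem_realRoots hp).2 (Polynomial.aeval_ofReal_eq_zero_iff.1 hw0))
  · exact hu w ((Polynomial.mem_upperRoots hp).2 ⟨hw0, h⟩)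

theorem Polynomial.card_realRoots_add_two_mul_card_upperRoots_le {p : Polynomial ℝ} (hp : p ≠ 0) :
    p.realRoots.card + 2 * p.upperRoots.card ≤ p.natDegree := by
  classical
  have h₁ : Disjoint (p.realRoots.image ((↑) : ℝ → ℂ)) p.upperRoots := by
    rw [Finset.disjoint_left]
    intro w hw hw'
    obtain ⟨y, _, rfl⟩ := Finset.mem_image.1 hw
    simpa using ((Polynomial.mem_upperRoots hp).1 hw').2
  have h₂ : Disjoint (p.realRoots.image ((↑) : ℝ → ℂ) ∪ p.upperRoots)
      (p.upperRoots.image (starRingEnd ℂ)) := by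
    rw [Finset.disjoint_left]
    intro w hw hw'
    obtain ⟨z, hz, rfl⟩ := Finset.mem_image.1 hw'
    have hz' := ((Polynomial.mem_upperRoots hp).1 hz).2
    rcases Finset.mem_union.1 hw with h | h
    · obtain ⟨y, _, hy⟩ := Finset.mem_image.1 h
      have := congrArg Complex.im hy
      simp at this
      linarith
    · have := ((Polynomial.mem_upperRoots hp).1 h).2
      simp at this
      linarith
  have hsub : p.realRoots.image ((↑) : ℝ → ℂ) ∪ p.upperRoots ∪
      p.upperRoots.image (starRingEnd ℂ) ⊆ (p.aroots ℂ).toFinset := by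
    intro w hw
    rw [Multiset.mem_toFinset, Polynomial.mem_aroots]
    refine ⟨hp, ?_⟩
    rcases Finset.mem_union.1 hw with h | h
    · rcases Finset.mem_union.1 h with h | h
      · obtain ⟨y, hy, rfl⟩ := Finset.mem_image.1 h
        exact Polynomial.aeval_ofReal_eq_zero_iff.2 ((Polynomial.mem_realRoots hp).1 hy)
      · exact ((Polynomial.mem_upperRoots hp).1 h).1
    · obtain ⟨z, hz, rfl⟩ := Finset.mem_image.1 h
      exact Polynomial.aeval_conj_eq_zero ((Polynomial.mem_upperRoots hp).1 hz).1
  have hcard := (Finset.card_le_card hsub).trans ((Multiset.toFinset_card_le _).trans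
    (Polynomial.card_roots' _))
  rw [Finset.card_union_of_disjoint h₂, Finset.card_union_of_disjoint h₁,
    Finset.card_image_of_injective _ Complex.ofReal_injective,
    Finset.card_image_of_injective _ (starRingEnd ℂ).injective, Polynomial.natDegree_map] at hcard
  omega

theorem le_finrank_of_finset_functionals {n : ℕ} {ι : Type*} [Fintype ι]
    (φ : ι → (Fin n → ℝ) →ₗ[ℝ] ℝ) :
    n ≤ Module.finrank ℝ (LinearMap.ker (LinearMap.pi φ)) + Fintype.card ι := by
  have h := LinearMap.finrank_range_add_finrank_ker (LinearMap.pi φ)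
  have h₂ := Submodule.finrank_le (LinearMap.range (LinearMap.pi φ))
  simp only [Module.finrank_fintype_fun_eq_card, Fintype.card_fin] at h h₂
  omega

/-- `polyValue` as a linear map in the coefficient vector. -/
noncomputable def polyValueLinear (n : ℕ) (w : ℂ) : (Fin n → ℝ) →ₗ[ℝ] ℂ where
  toFun v := polyValue v w
  map_add' u v := by simp [polyValue, add_mul, Finset.sum_add_distrib]
  map_smul' a v := by simp [polyValue, Finset.mul_sum, mul_assoc]

open Polynomial Matrix in
theorem finrank_le_card_upperRoots_of_hermite_neg {n : ℕ} (A : Matrix (Fin n) (Fin n) ℝ)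
    (p : Polynomial ℝ)
    (hp : p ≠ 0) (hA : ∀ (v : Fin n → ℝ) (i : Fin n), (((A *ᵥ v) i : ℝ) : ℂ) =
      ((p.aroots ℂ).map fun w => w ^ (i : ℕ) * polyValue v w).sum)
    (N : Submodule ℝ (Fin n → ℝ)) (hN : ∀ v ∈ N, v ≠ 0 → v ⬝ᵥ A *ᵥ v < 0) :
    Module.finrank ℝ N ≤ p.upperRoots.card := by
  let φ : p.upperRoots → (Fin n → ℝ) →ₗ[ℝ] ℝ := fun w => Complex.imLm ∘ₗ polyValueLinear n w
  have hφ := le_finrank_of_finset_functionals φ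
  have hdisj : N ⊓ LinearMap.ker (LinearMap.pi φ) = ⊥ := by
    rw [eq_bot_iff]
    rintro v ⟨hv, hvφ⟩
    by_contra hv0
    have him : ∀ w ∈ p.aroots ℂ, (polyValue v w).im = 0 := by
      refine Polynomial.forall_mem_aroots_of_upper hp (fun y _ => polyValue_ofReal_im v y)
        (fun w hw => ?_) (fun w hw => by rw [polyValue_conj]; simp [hw])
      exact congrFun (LinearMap.mem_ker.1 hvφ) ⟨w, hw⟩
    have hsum : v ⬝ᵥ A *ᵥ v = ((p.aroots ℂ).map fun w => (polyValue v w).re ^ 2).sum := by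
      have h := congrArg Complex.reAddGroupHom (Polynomial.dotProduct_hermite_eq_sum A _ hA v)
      rw [map_multiset_sum, Multiset.map_map] at h
      refine Eq.trans h (congrArg _ (Multiset.map_congr rfl fun w hw => ?_))
      simp [sq, him w hw]
    have hneg := hN v hv (by simpa using hv0)
    rw [hsum] at hneg
    exact hneg.not_ge (Multiset.sum_nonneg fun a ha => by
      obtain ⟨w, _, rfl⟩ := Multiset.mem_map.1 ha
      exact sq_nonneg _)
  have h := Submodule.finrank_sup_add_finrank_inf_eq N (LinearMap.ker (LinearMap.pi φ))
  have h₂ := Submodule.finrank_le (N ⊔ LinearMap.ker (LinearMap.pi φ))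
  rw [hdisj, finrank_bot] at h
  simp only [Module.finrank_fintype_fun_eq_card, Fintype.card_fin, Fintype.card_coe] at h h₂ hφ
  omega

open Polynomial Matrix in
theorem exists_nonpositive_subspace_of_hermite {n : ℕ} (A : Matrix (Fin n) (Fin n) ℝ)
    (p : Polynomial ℝ) (hp : p ≠ 0) (hA : ∀ (v : Fin n → ℝ) (i : Fin n), (((A *ᵥ v) i : ℝ) : ℂ) =
      ((p.aroots ℂ).map fun w => w ^ (i : ℕ) * polyValue v w).sum) :
    ∃ L : Submodule ℝ (Fin n → ℝ),
      n ≤ Module.finrank ℝ L + (p.realRoots.card + p.upperRoots.card) ∧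
      (∀ v ∈ L, v ⬝ᵥ A *ᵥ v ≤ 0) ∧ (∀ v ∈ L, v ⬝ᵥ A *ᵥ v = 0 → A *ᵥ v = 0) := by
  let φ : p.realRoots ⊕ p.upperRoots → (Fin n → ℝ) →ₗ[ℝ] ℝ :=
    Sum.elim (fun y => Complex.reLm ∘ₗ polyValueLinear n (y : ℝ))
      (fun w => Complex.reLm ∘ₗ polyValueLinear n w)
  have hφ := le_finrank_of_finset_functionals φ
  have hre : ∀ v ∈ LinearMap.ker (LinearMap.pi φ), ∀ w ∈ p.aroots ℂ, (polyValue v w).re = 0 := by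
    intro v hv
    refine Polynomial.forall_mem_aroots_of_upper hp (fun y hy => ?_)
      (fun w hw => ?_) (fun w hw => by rw [polyValue_conj]; simp [hw])
    · exact congrFun (LinearMap.mem_ker.1 hv) (Sum.inl ⟨y, hy⟩)
    · exact congrFun (LinearMap.mem_ker.1 hv) (Sum.inr ⟨w, hw⟩)
  have hsum : ∀ v ∈ LinearMap.ker (LinearMap.pi φ),
      v ⬝ᵥ A *ᵥ v = -((p.aroots ℂ).map fun w => (polyValue v w).im ^ 2).sum := by
    intro v hv
    have h := congrArg Complex.reAddGroupHom (Polynomial.dotProduct_hermite_eq_sum A _ hA v)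
    rw [map_multiset_sum, Multiset.map_map] at h
    rw [← Multiset.sum_map_neg]
    refine Eq.trans h (congrArg _ (Multiset.map_congr rfl fun w hw => ?_))
    simp [sq, hre v hv w hw]
  refine ⟨LinearMap.ker (LinearMap.pi φ), by simpa using hφ, fun v hv => ?_, fun v hv h0 => ?_⟩
  · rw [hsum v hv, neg_nonpos]
    exact Multiset.sum_nonneg fun a ha => by
      obtain ⟨w, _, rfl⟩ := Multiset.mem_map.1 ha
      exact sq_nonneg _
  · rw [hsum v hv, neg_eq_zero,
      Multiset.sum_map_eq_zero_iff_of_nonneg _ _ fun w _ => sq_nonneg _] at h0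
    ext i
    have h1 := hA v i
    rw [Multiset.map_congr (g := fun _ => (0 : ℂ)) rfl] at h1
    · simpa using h1
    · intro w hw
      have : polyValue v w = 0 := Complex.ext (hre v hv w hw) (by simpa using h0 w hw)
      simp [this]

open Polynomial Matrix Filter Topology in
/-- The roots of a family of monic polynomials near a parameter `x₀`, compared with the order of
vanishing at `x₀` of the determinant of the Hermite matrix. -/
theorem eventually_two_mul_natDegree_le (F : Polynomial (Polynomial ℝ)) (hF : F.Monic)
    (H : Matrix (Fin F.natDegree) (Fin F.natDegree) (Polynomial ℝ)) (hH : H.IsSymm)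
    (hdet : H.det ≠ 0)
    (hA : ∀ (x : ℝ) (v : Fin F.natDegree → ℝ) (i : Fin F.natDegree),
      (((H.map (eval x) *ᵥ v) i : ℝ) : ℂ) =
        (((F.map (evalRingHom x)).aroots ℂ).map fun w => w ^ (i : ℕ) * polyValue v w).sum)
    (x₀ : ℝ) :
    ∀ᶠ x in 𝓝[>] x₀, ∀ᶠ x' in 𝓝[<] x₀, 2 * F.natDegree ≤
      2 * ((F.map (evalRingHom x₀)).realRoots.card + (F.map (evalRingHom x₀)).upperRoots.card) +
        (F.map (evalRingHom x)).upperRoots.card + (F.map (evalRingHom x')).upperRoots.card +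
        H.det.rootMultiplicity x₀ := by
  have hne : ∀ x, F.map (evalRingHom x) ≠ 0 := fun x => (hF.map _).ne_zero
  obtain ⟨L, hLdim, hL, hL₀⟩ := exists_nonpositive_subspace_of_hermite _ _ (hne x₀) (hA x₀)
  obtain ⟨N₁, N₂, hdim, h₁, h₂⟩ := exists_negative_subspaces_near H hH hdet x₀ L hL hL₀
  filter_upwards [h₁] with x hx
  filter_upwards [h₂] with x' hx'
  have := finrank_le_card_upperRoots_of_hermite_neg _ _ (hne x) (hA x) N₁ hx
  have := finrank_le_card_upperRoots_of_hermite_neg _ _ (hne x') (hA x') N₂ hx'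
  omega

theorem Multiset.pow_card_le_norm_prod (s : Multiset ℂ) {ε : ℝ} (hε : 0 ≤ ε)
    (h : ∀ z ∈ s, ε ≤ ‖z‖) : ε ^ s.card ≤ ‖s.prod‖ := by
  induction s using Multiset.induction_on with
  | empty => simp
  | cons a s ih =>
    rw [Multiset.card_cons, Multiset.prod_cons, norm_mul, pow_succ']
    exact mul_le_mul (h a (Multiset.mem_cons_self a s))
      (ih fun z hz => h z (Multiset.mem_cons_of_mem hz)) (by positivity) (norm_nonneg _)

theorem Polynomial.continuous_eval_map_evalRingHom (F : Polynomial (Polynomial ℝ)) :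
    Continuous fun p : ℝ × ℝ => (F.map (Polynomial.evalRingHom p.1)).eval p.2 := by
  simp only [Polynomial.eval_map, Polynomial.eval₂_eq_sum_range]
  simp only [Polynomial.coe_evalRingHom]
  fun_prop

open Polynomial Filter Topology in
/-- Complex roots of a family of monic polynomials persist. -/
theorem Polynomial.eventually_exists_root_near (F : Polynomial (Polynomial ℝ)) (hF : F.Monic)
    (x₀ : ℝ) (w : ℂ) (hw : aeval w (F.map (evalRingHom x₀)) = 0) {ε : ℝ} (hε : 0 < ε) :
    ∀ᶠ x in 𝓝 x₀, ∃ η : ℂ, aeval η (F.map (evalRingHom x)) = 0 ∧ ‖η - w‖ < ε := by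
  have hcont : Continuous fun x : ℝ => ‖aeval w (F.map (evalRingHom x))‖ := by
    have : (fun x : ℝ => ‖aeval w (F.map (evalRingHom x))‖) =
        fun x : ℝ => ‖∑ i ∈ Finset.range (F.natDegree + 1),
          (((F.coeff i).eval x : ℝ) : ℂ) * w ^ i‖ := by
      funext x
      rw [aeval_def, eval₂_eq_sum_range, hF.natDegree_map]
      simp
    rw [this]
    refine continuous_norm.comp (continuous_finsetSum _ fun i _ => ?_)
    fun_prop
  have hlt : ∀ᶠ x in 𝓝 x₀, ‖aeval w (F.map (evalRingHom x))‖ < ε ^ F.natDegree :=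
    hcont.continuousAt.eventually_lt_const (by
      simp only [hw, norm_zero]
      positivity)
  filter_upwards [hlt] with x hx
  by_contra! h
  have hmonic : (F.map (evalRingHom x)).Monic := hF.map _
  have hsplit : ((F.map (evalRingHom x)).map (algebraMap ℝ ℂ)).Splits := IsAlgClosed.splits _
  have hcard : ((F.map (evalRingHom x)).aroots ℂ).card = F.natDegree := by
    rw [← hF.natDegree_map (evalRingHom x),
      ← natDegree_map (p := F.map (evalRingHom x)) (algebraMap ℝ ℂ)]
    exact splits_iff_card_roots.1 hsplit
  rw [hsplit.aeval_eq_prod_aroots_of_monic hmonic] at hx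
  have := Multiset.pow_card_le_norm_prod (((F.map (evalRingHom x)).aroots ℂ).map fun a => w - a)
    hε.le (by
      intro z hz
      obtain ⟨η, hη, rfl⟩ := Multiset.mem_map.1 hz
      rw [norm_sub_rev]
      exact h η (mem_aroots.1 hη).2)
  rw [Multiset.card_map, hcard] at this
  exact hx.not_ge this

/-- The complement of the plane curve defined by a bivariate polynomial. -/
abbrev Polynomial.CurveCompl (F : Polynomial (Polynomial ℝ)) : Type :=
  {p : ℝ × ℝ // (F.map (Polynomial.evalRingHom p.1)).eval p.2 ≠ 0}

theorem ConnectedComponents.mk_eq_mk_of_isPreconnected {X : Type*} [TopologicalSpace X]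
    {P : X → Prop} {S : Set X} (hS : IsPreconnected S) (hSP : ∀ z ∈ S, P z) {p q : {z // P z}}
    (hp : p.1 ∈ S) (hq : q.1 ∈ S) : ConnectedComponents.mk p = ConnectedComponents.mk q := by
  have himage : (Subtype.val : {z // P z} → X) '' (Subtype.val ⁻¹' S) = S := by
    ext z
    constructor
    · rintro ⟨z, hz, rfl⟩
      exact hz
    · exact fun hz => ⟨⟨z, hSP z hz⟩, hz, rfl⟩
  have hind : Topology.IsInducing (Subtype.val : {z // P z} → X) := ⟨rfl⟩
  have hpre : IsPreconnected ((Subtype.val : {z // P z} → X) ⁻¹' S) := by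
    rw [← hind.isPreconnected_image, himage]
    exact hS
  exact ConnectedComponents.coe_eq_coe'.2 (hpre.subset_connectedComponent hq hp)

namespace Polynomial.CurveCompl

variable {F : Polynomial (Polynomial ℝ)}

theorem mk_eq_mk_of_horizontal (p q : F.CurveCompl) (h : p.1.2 = q.1.2)
    (hF : ∀ x ∈ Set.uIcc p.1.1 q.1.1, (F.map (evalRingHom x)).eval p.1.2 ≠ 0) :
    ConnectedComponents.mk p = ConnectedComponents.mk q := by
  refine ConnectedComponents.mk_eq_mk_of_isPreconnected
    (S := (fun x => (x, p.1.2)) '' Set.uIcc p.1.1 q.1.1)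
    (isPreconnected_uIcc.image _ (by fun_prop)) ?_ ⟨p.1.1, by simp, rfl⟩ ⟨q.1.1, by simp, ?_⟩
  · rintro _ ⟨x, hx, rfl⟩
    exact hF x hx
  · rw [h]

theorem mk_eq_mk_of_vertical (p q : F.CurveCompl) (h : p.1.1 = q.1.1)
    (hF : ∀ y ∈ Set.uIcc p.1.2 q.1.2, (F.map (evalRingHom p.1.1)).eval y ≠ 0) :
    ConnectedComponents.mk p = ConnectedComponents.mk q := by
  refine ConnectedComponents.mk_eq_mk_of_isPreconnected
    (S := (fun y => (p.1.1, y)) '' Set.uIcc p.1.2 q.1.2)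
    (isPreconnected_uIcc.image _ (by fun_prop)) ?_ ⟨p.1.2, by simp, rfl⟩ ⟨q.1.2, by simp, ?_⟩
  · rintro _ ⟨y, hy, rfl⟩
    exact hF y hy
  · rw [h]

theorem mk_eq_mk_of_card_roots_lt_eq (hF : F.Monic) (p q : F.CurveCompl) (h : p.1.1 = q.1.1)
    (hcard : {y ∈ (F.map (evalRingHom p.1.1)).realRoots | y < p.1.2}.card =
      {y ∈ (F.map (evalRingHom p.1.1)).realRoots | y < q.1.2}.card) :
    ConnectedComponents.mk p = ConnectedComponents.mk q := by
  wlog hle : p.1.2 ≤ q.1.2 generalizing p q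
  · refine (this q p h.symm ?_ (le_of_not_ge hle)).symm
    rw [← h, hcard]
  refine mk_eq_mk_of_vertical p q h fun y hy h0 => ?_
  rw [Set.uIcc_of_le hle] at hy
  have hsub : {y ∈ (F.map (evalRingHom p.1.1)).realRoots | y < p.1.2} ⊆
      {y ∈ (F.map (evalRingHom p.1.1)).realRoots | y < q.1.2} :=
    Finset.monotone_filter_right _ fun y _ hy => lt_of_lt_of_le hy hle
  have heq := Finset.eq_of_subset_of_card_le hsub hcard.ge
  have hyq : y < q.1.2 := by
    refine lt_of_le_of_ne hy.2 fun h' => q.2 ?_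
    rw [← h, ← h']
    exact h0
  have hy' : y ∈ {y ∈ (F.map (evalRingHom p.1.1)).realRoots | y < q.1.2} :=
    Finset.mem_filter.2 ⟨(mem_realRoots (hF.map _).ne_zero).2 h0, hyq⟩
  rw [← heq] at hy'
  exact (Finset.mem_filter.1 hy').2.not_ge hy.1

end Polynomial.CurveCompl

open Filter Topology in
theorem Finset.eventually_two_mul_le_norm_sub (W : Finset ℂ) :
    ∀ᶠ ε : ℝ in 𝓝[>] 0, ∀ w ∈ W, ∀ w' ∈ W, w ≠ w' → 2 * ε ≤ ‖w - w'‖ := by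
  refine (Filter.eventually_all_finset W).2 fun w _ =>
    (Filter.eventually_all_finset W).2 fun w' _ => ?_
  by_cases h : w = w'
  · exact .of_forall fun ε h' => absurd h h'
  · have hcont : Continuous fun ε : ℝ => 2 * ε := by fun_prop
    have hpos : 2 * (0 : ℝ) < ‖w - w'‖ := by simpa using norm_pos_iff.2 (sub_ne_zero.2 h)
    filter_upwards [nhdsWithin_le_nhds (hcont.continuousAt.eventually_lt_const hpos)]
      with ε hε _ using hε.le

theorem Finset.card_le_card_of_separated {W U : Finset ℂ} {ε : ℝ}
    (hsep : ∀ w ∈ W, ∀ w' ∈ W, w ≠ w' → 2 * ε ≤ ‖w - w'‖)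
    (hnear : ∀ w ∈ W, ∃ η ∈ U, ‖η - w‖ < ε) : W.card ≤ U.card := by
  choose! g hgU hg using hnear
  refine Finset.card_le_card_of_injOn g hgU fun w hw w' hw' h => ?_
  by_contra hne
  have h₁ := hsep w hw w' hw' hne
  have h₂ := norm_sub_le (g w' - w') (g w - w)
  have h₃ : g w' - w' - (g w - w) = w - w' := by rw [h]; ring
  rw [h₃] at h₂
  linarith [hg w hw, hg w' hw']

theorem Finset.card_filter_lt_strict {R : Finset ℝ} {z z' ρ : ℝ} (hρ : ρ ∈ R) (hz : z ≤ ρ)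
    (hz' : ρ < z') : {y ∈ R | y < z}.card < {y ∈ R | y < z'}.card := by
  refine Finset.card_lt_card ⟨Finset.monotone_filter_right _ fun y _ hy => ?_, fun h => ?_⟩
  · exact hy.trans (hz.trans_lt hz')
  · exact (Finset.mem_filter.1 (h (Finset.mem_filter.2 ⟨hρ, hz'⟩))).2.not_ge hz

/-- Gaps of `R` counted by sample points just above a family of separated points
(each close to `R`), by one sample point below all of them, and by further points in other gaps. -/
theorem Finset.card_add_card_le_of_gaps {ι : Type*} (R E : Finset ℝ) (𝒞 : Finset ι) (f : ι → ℝ)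
    {ε b : ℝ} (hsep : ∀ y ∈ E, ∀ y' ∈ E, y < y' → 2 * ε ≤ y' - y)
    (hnear : ∀ y ∈ E, ∃ ρ ∈ R, |ρ - y| < ε) (hb : ∀ y ∈ E, b < y - ε)
    (hinj : ∀ C ∈ 𝒞, ∀ C' ∈ 𝒞, {y ∈ R | y < f C}.card = {y ∈ R | y < f C'}.card → C = C')
    (hE : ∀ C ∈ 𝒞, ∀ z ∈ E, {y ∈ R | y < f C}.card ≠ {y ∈ R | y < z + ε}.card)
    (hbot : ∀ C ∈ 𝒞, {y ∈ R | y < f C}.card ≠ {y ∈ R | y < b}.card) :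
    𝒞.card + E.card ≤ R.card := by
  classical
  set gap : ℝ → ℕ := fun z => {y ∈ R | y < z}.card with hgap
  have hstrict : ∀ y ∈ E, ∀ z ≤ y - ε, gap z < gap (y + ε) := by
    intro y hy z hz
    obtain ⟨ρ, hρ, hρy⟩ := hnear y hy
    rw [abs_lt] at hρy
    exact Finset.card_filter_lt_strict hρ (by linarith) (by linarith)
  have hinjE : Set.InjOn (fun y => gap (y + ε)) E := by
    intro y hy y' hy' h
    by_contra hne
    rcases lt_or_gt_of_ne hne with hlt | hlt
    · exact (hstrict y' hy' (y + ε) (by linarith [hsep y hy y' hy' hlt])).ne h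
    · exact (hstrict y hy (y' + ε) (by linarith [hsep y' hy' y hy hlt])).ne' h
  have hcardE := Finset.card_image_of_injOn hinjE
  have hcardC : (𝒞.image fun C => gap (f C)).card = 𝒞.card :=
    Finset.card_image_of_injOn fun C hC C' hC' h => hinj C hC C' hC' h
  have hnot : gap b ∉ E.image fun y => gap (y + ε) := by
    intro h
    obtain ⟨y, hy, hyb⟩ := Finset.mem_image.1 h
    exact (hstrict y hy b (hb y hy).le).ne' hyb
  have hdisj : Disjoint (𝒞.image fun C => gap (f C))
      (insert (gap b) (E.image fun y => gap (y + ε))) := by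
    rw [Finset.disjoint_left]
    intro m hm hm'
    obtain ⟨C, hC, rfl⟩ := Finset.mem_image.1 hm
    rcases Finset.mem_insert.1 hm' with h | h
    · exact hbot C hC h
    · obtain ⟨y, hy, hyb⟩ := Finset.mem_image.1 h
      exact hE C hC y hy hyb.symm
  have hsub : (𝒞.image fun C => gap (f C)) ∪
      insert (gap b) (E.image fun y => gap (y + ε)) ⊆ Finset.range (R.card + 1) := by
    have hle : ∀ z, gap z < R.card + 1 := fun z => Nat.lt_succ_of_le (Finset.card_filter_le _ _)
    intro m hm
    simp only [Finset.mem_union, Finset.mem_insert, Finset.mem_image] at hm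
    rw [Finset.mem_range]
    rcases hm with ⟨C, _, rfl⟩ | rfl | ⟨y, _, rfl⟩ <;> exact hle _
  have hcard := Finset.card_le_card hsub
  rw [Finset.card_union_of_disjoint hdisj, Finset.card_insert_of_notMem hnot, hcardE, hcardC,
    Finset.card_range] at hcard
  omega

open Filter Topology in
theorem Polynomial.eventually_forall_uIcc_eval_ne_zero {F : Polynomial (Polynomial ℝ)} {x₀ z : ℝ}
    (hz : (F.map (evalRingHom x₀)).eval z ≠ 0) :
    ∀ᶠ x in 𝓝 x₀, ∀ x' ∈ Set.uIcc x x₀, (F.map (evalRingHom x')).eval z ≠ 0 := by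
  have hcont : Continuous fun x : ℝ => (F.map (evalRingHom x)).eval z :=
    F.continuous_eval_map_evalRingHom.comp (Continuous.prodMk continuous_id continuous_const)
  obtain ⟨δ, hδ, hball⟩ := Metric.eventually_nhds_iff_ball.1 (hcont.continuousAt.eventually_ne hz)
  filter_upwards [Metric.ball_mem_nhds x₀ hδ] with x hx x' hx'
  refine hball x' ?_
  rw [Real.ball_eq_Ioo] at hx ⊢
  exact Set.OrdConnected.uIcc_subset Set.ordConnected_Ioo hx (by simp [hδ]) hx'

open Filter Topology in
/-- A component that meets the vertical line over `x` but not the one over a nearby `x₀`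
accounts for roots that are lost at `x`. -/
theorem Polynomial.CurveCompl.eventually_card_add_le {F : Polynomial (Polynomial ℝ)} (hF : F.Monic)
    (x₀ : ℝ) :
    ∀ᶠ x in 𝓝 x₀, ∀ 𝒞 : Finset (ConnectedComponents F.CurveCompl),
      (∀ C ∈ 𝒞, (∃ p : F.CurveCompl, ConnectedComponents.mk p = C ∧ p.1.1 = x) ∧
        ∀ p : F.CurveCompl, ConnectedComponents.mk p = C → p.1.1 ≠ x₀) →
      𝒞.card + (F.map (evalRingHom x)).upperRoots.card + (F.map (evalRingHom x₀)).upperRoots.card +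
        (F.map (evalRingHom x₀)).realRoots.card ≤ F.natDegree := by
  classical
  have hne : ∀ x, F.map (evalRingHom x) ≠ 0 := fun x => (hF.map _).ne_zero
  set Y := (F.map (evalRingHom x₀)).realRoots with hY
  set U := (F.map (evalRingHom x₀)).upperRoots with hU
  set W : Finset ℂ := Y.image ((↑) : ℝ → ℂ) ∪ U with hW
  have hWroot : ∀ w ∈ W, aeval w (F.map (evalRingHom x₀)) = 0 := by
    intro w hw
    rcases Finset.mem_union.1 hw with h | h
    · obtain ⟨y, hy, rfl⟩ := Finset.mem_image.1 h
      exact aeval_ofReal_eq_zero_iff.2 ((mem_realRoots (hne x₀)).1 hy)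
    · exact ((mem_upperRoots (hne x₀)).1 h).1
  have him : ∀ᶠ ε : ℝ in 𝓝[>] 0, ∀ w ∈ U, ε < w.im :=
    (Filter.eventually_all_finset U).2 fun w hw =>
      nhdsWithin_le_nhds (eventually_lt_nhds ((mem_upperRoots (hne x₀)).1 hw).2)
  obtain ⟨ε, hsep, hεim, hε⟩ :=
    ((W.eventually_two_mul_le_norm_sub.and him).and self_mem_nhdsWithin).exists.imp
      fun ε h => (⟨h.1.1, h.1.2, h.2⟩ : _ ∧ _ ∧ _)
  replace hε : 0 < ε := hε
  obtain ⟨b, hb⟩ : ∃ b, ∀ y ∈ Y, b < y - ε := by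
    obtain ⟨b, hb⟩ := Y.bddBelow
    exact ⟨b - ε - 1, fun y hy => by linarith [hb hy]⟩
  have hsepY : ∀ y ∈ Y, ∀ y' ∈ Y, y < y' → 2 * ε ≤ y' - y := by
    intro y hy y' hy' hlt
    have := hsep y' (Finset.mem_union_left _ (Finset.mem_image_of_mem _ hy'))
      y (Finset.mem_union_left _ (Finset.mem_image_of_mem _ hy)) (by simpa using hlt.ne')
    rwa [← Complex.ofReal_sub, Complex.norm_real, Real.norm_eq_abs,
      abs_of_pos (by linarith)] at this
  have hzE : ∀ y ∈ Y, (F.map (evalRingHom x₀)).eval (y + ε) ≠ 0 := by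
    intro y hy h
    have := hsepY y hy (y + ε) ((mem_realRoots (hne x₀)).2 h) (by linarith)
    linarith
  have hzb : (F.map (evalRingHom x₀)).eval b ≠ 0 := by
    intro h
    have := hb b ((mem_realRoots (hne x₀)).2 h)
    linarith
  have hnear := (Filter.eventually_all_finset W).2 fun w hw =>
    eventually_exists_root_near F hF x₀ w (hWroot w hw) hε
  have hsampleY := (Filter.eventually_all_finset Y).2 fun y hy =>
    eventually_forall_uIcc_eval_ne_zero (hzE y hy)
  filter_upwards [hnear, hsampleY, eventually_forall_uIcc_eval_ne_zero hzb] with x hxW hxY hxb 𝒞 h𝒞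
  set R := (F.map (evalRingHom x)).realRoots with hR
  set E := {y ∈ Y | ∃ ρ ∈ R, |ρ - y| < ε} with hE
  have hdiff : ∀ C ∈ 𝒞, ∀ p : F.CurveCompl, ConnectedComponents.mk p = C → p.1.1 = x →
      ∀ z, (∀ x' ∈ Set.uIcc x x₀, (F.map (evalRingHom x')).eval z ≠ 0) →
      {y ∈ R | y < p.1.2}.card ≠ {y ∈ R | y < z}.card := by
    intro C hC p hpC hpx z hz hcard
    let q : F.CurveCompl := ⟨(x, z), hz x Set.left_mem_uIcc⟩
    let q₀ : F.CurveCompl := ⟨(x₀, z), hz x₀ Set.right_mem_uIcc⟩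
    have h₁ : ConnectedComponents.mk p = ConnectedComponents.mk q := by
      refine mk_eq_mk_of_card_roots_lt_eq hF p q hpx ?_
      rw [hpx]
      exact hcard
    have h₂ : ConnectedComponents.mk q = ConnectedComponents.mk q₀ :=
      mk_eq_mk_of_horizontal q q₀ rfl hz
    exact (h𝒞 C hC).2 q₀ (by rw [← h₂, ← h₁, hpC]) rfl
  have hpoint : ∀ C ∈ 𝒞, ∃ y, ∃ p : F.CurveCompl, ConnectedComponents.mk p = C ∧ p.1 = (x, y) := by
    intro C hC
    obtain ⟨p, hpC, hpx⟩ := (h𝒞 C hC).1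
    exact ⟨p.1.2, p, hpC, Prod.ext hpx rfl⟩
  choose! f hf using hpoint
  have hfdiff : ∀ C ∈ 𝒞, ∀ z, (∀ x' ∈ Set.uIcc x x₀, (F.map (evalRingHom x')).eval z ≠ 0) →
      {y ∈ R | y < f C}.card ≠ {y ∈ R | y < z}.card := by
    intro C hC z hz
    obtain ⟨p, hpC, hp⟩ := hf C hC
    have := hdiff C hC p hpC (by rw [hp]) z hz
    rwa [hp] at this
  have hgaps : 𝒞.card + E.card ≤ R.card := by
    refine Finset.card_add_card_le_of_gaps R E 𝒞 f (ε := ε) (b := b)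
      (fun y hy y' hy' => hsepY y (Finset.mem_filter.1 hy).1 y' (Finset.mem_filter.1 hy').1)
      (fun y hy => (Finset.mem_filter.1 hy).2) (fun y hy => hb y (Finset.mem_filter.1 hy).1)
      ?_ (fun C hC z hz => hfdiff C hC _ (hxY z (Finset.mem_filter.1 hz).1))
      (fun C hC => hfdiff C hC _ hxb)
    intro C hC C' hC' h
    obtain ⟨p, hpC, hp⟩ := hf C hC
    obtain ⟨q, hqC, hq⟩ := hf C' hC'
    rw [← hpC, ← hqC]
    refine mk_eq_mk_of_card_roots_lt_eq hF p q (by rw [hp, hq]) ?_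
    rw [hp, hq]
    exact h
  have hupper : ((Y \ E).image ((↑) : ℝ → ℂ) ∪ U).card ≤
      (F.map (evalRingHom x)).upperRoots.card := by
    have hsub : (Y \ E).image ((↑) : ℝ → ℂ) ∪ U ⊆ W :=
      Finset.union_subset_union (Finset.image_subset_image Finset.sdiff_subset) subset_rfl
    refine Finset.card_le_card_of_separated (ε := ε)
      (fun w hw w' hw' => hsep w (hsub hw) w' (hsub hw')) fun w hw => ?_
    obtain ⟨η, hη, hηw⟩ := hxW w (hsub hw)
    rcases Finset.mem_union.1 hw with h | h
    · obtain ⟨y, hy, rfl⟩ := Finset.mem_image.1 h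
      rw [Finset.mem_sdiff] at hy
      rcases lt_trichotomy η.im 0 with hlt | heq | hgt
      · refine ⟨starRingEnd ℂ η, (mem_upperRoots (hne x)).2 ⟨aeval_conj_eq_zero hη, by simpa⟩, ?_⟩
        rwa [← Complex.conj_ofReal y, ← map_sub, Complex.norm_conj]
      · exfalso
        have hre : ((η.re : ℝ) : ℂ) = η := Complex.ext (by simp) (by simp [heq])
        rw [← hre] at hη hηw
        refine hy.2 (Finset.mem_filter.2 ⟨hy.1, η.re,
          (mem_realRoots (hne x)).2 (aeval_ofReal_eq_zero_iff.1 hη), ?_⟩)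
        rwa [← Complex.ofReal_sub, Complex.norm_real, Real.norm_eq_abs] at hηw
      · exact ⟨η, (mem_upperRoots (hne x)).2 ⟨hη, hgt⟩, hηw⟩
    · refine ⟨η, (mem_upperRoots (hne x)).2 ⟨hη, ?_⟩, hηw⟩
      have h₁ := (abs_lt.1 ((Complex.abs_im_le_norm (η - w)).trans_lt hηw)).1
      rw [Complex.sub_im] at h₁
      linarith [hεim w h]
  have hdisj : Disjoint ((Y \ E).image ((↑) : ℝ → ℂ)) U := by
    rw [Finset.disjoint_left]
    intro w hw hw'
    obtain ⟨y, _, rfl⟩ := Finset.mem_image.1 hw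
    simpa using ((mem_upperRoots (hne x₀)).1 hw').2
  rw [Finset.card_union_of_disjoint hdisj,
    Finset.card_image_of_injective _ Complex.ofReal_injective]
    at hupper
  have hYE : (Y \ E).card + E.card = Y.card :=
    Finset.card_sdiff_add_card_eq_card (Finset.filter_subset _ _ : E ⊆ Y)
  have htotal : R.card + _ ≤ _ := card_realRoots_add_two_mul_card_upperRoots_le (hne x)
  rw [hF.natDegree_map] at htotal
  omega

open Filter Topology in
theorem Set.OrdConnected.eventually_atBot_or_nhdsGT {α : Type*} [ConditionallyCompleteLinearOrder α]
    [TopologicalSpace α] [OrderTopology α] [DenselyOrdered α] [NoMinOrder α] {I : Set α}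
    (hI : I.OrdConnected) (hopen : IsOpen I) (hne : I.Nonempty) :
    (∀ᶠ x in atBot, x ∈ I) ∨ ∃ x₀ ∉ I, ∀ᶠ x in 𝓝[>] x₀, x ∈ I := by
  obtain ⟨a, ha⟩ := hne
  by_cases hbdd : BddBelow I
  · right
    have hnot : sInf I ∉ I := by
      intro h
      obtain ⟨y, hy, hyI⟩ := exists_Ioc_subset_of_mem_nhds (hopen.mem_nhds h) (exists_lt _)
      obtain ⟨z, hyz, hz⟩ := exists_between hy
      exact (csInf_le hbdd (hyI ⟨hyz, hz.le⟩)).not_gt hz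
    have hlt : sInf I < a := lt_of_le_of_ne (csInf_le hbdd ha) fun h => hnot (h ▸ ha)
    refine ⟨sInf I, hnot, ?_⟩
    filter_upwards [Ioo_mem_nhdsGT hlt] with x hx
    obtain ⟨y, hyI, hyx⟩ := exists_lt_of_csInf_lt ⟨a, ha⟩ hx.1
    exact hI.out hyI ha ⟨hyx.le, hx.2.le⟩
  · left
    filter_upwards [eventually_le_atBot a] with x hx
    obtain ⟨y, hyI, hyx⟩ := not_bddBelow_iff.1 hbdd x
    exact hI.out hyI ha ⟨hyx.le, hx⟩

open Filter Topology in
theorem Set.OrdConnected.eventually_atTop_or_nhdsLT {α : Type*} [ConditionallyCompleteLinearOrder α]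
    [TopologicalSpace α] [OrderTopology α] [DenselyOrdered α] [NoMaxOrder α] {I : Set α}
    (hI : I.OrdConnected) (hopen : IsOpen I) (hne : I.Nonempty) :
    (∀ᶠ x in atTop, x ∈ I) ∨ ∃ x₀ ∉ I, ∀ᶠ x in 𝓝[<] x₀, x ∈ I :=
  Set.OrdConnected.eventually_atBot_or_nhdsGT (α := αᵒᵈ) (I := I) hI.dual hopen hne

namespace Polynomial.CurveCompl

variable {F : Polynomial (Polynomial ℝ)}

/-- The projection of a component to the first coordinate. -/
def shadow (C : ConnectedComponents F.CurveCompl) : Set ℝ :=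
  {x | ∃ p : F.CurveCompl, ConnectedComponents.mk p = C ∧ p.1.1 = x}

theorem shadow_nonempty (C : ConnectedComponents F.CurveCompl) : (shadow C).Nonempty := by
  obtain ⟨p, hp⟩ := ConnectedComponents.surjective_coe C
  exact ⟨p.1.1, p, hp, rfl⟩

theorem isOpen_shadow (C : ConnectedComponents F.CurveCompl) : IsOpen (shadow C) := by
  refine isOpen_iff_mem_nhds.2 ?_
  rintro _ ⟨p, hp, rfl⟩
  filter_upwards [eventually_forall_uIcc_eval_ne_zero p.2] with x hx
  let q : F.CurveCompl := ⟨(x, p.1.2), hx x Set.left_mem_uIcc⟩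
  exact ⟨q, (mk_eq_mk_of_horizontal q p rfl hx).trans hp, rfl⟩

theorem ordConnected_shadow (C : ConnectedComponents F.CurveCompl) : (shadow C).OrdConnected := by
  obtain ⟨p, rfl⟩ := ConnectedComponents.surjective_coe C
  have h : shadow (ConnectedComponents.mk p) =
      (fun q : F.CurveCompl => q.1.1) '' connectedComponent p := by
    ext x
    refine exists_congr fun q => and_congr_left' ?_
    rw [ConnectedComponents.coe_eq_coe']
  rw [h]
  exact (isPreconnected_connectedComponent.image _ (by fun_prop)).ordConnected

theorem card_le_of_forall_mem_shadow (hF : F.Monic) (x : ℝ)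
    (𝒞 : Finset (ConnectedComponents F.CurveCompl)) (h : ∀ C ∈ 𝒞, x ∈ shadow C) :
    𝒞.card ≤ F.natDegree + 1 := by
  set R := (F.map (evalRingHom x)).realRoots
  have hpoint : ∀ C ∈ 𝒞, ∃ y, ∃ p : F.CurveCompl, ConnectedComponents.mk p = C ∧ p.1 = (x, y) := by
    intro C hC
    obtain ⟨p, hpC, hpx⟩ := h C hC
    exact ⟨p.1.2, p, hpC, Prod.ext hpx rfl⟩
  choose! f hf using hpoint
  have hle : 𝒞.card ≤ (Finset.range (R.card + 1)).card := by
    refine Finset.card_le_card_of_injOn (fun C => {y ∈ R | y < f C}.card) (fun C _ => ?_) ?_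
    · exact Finset.mem_coe.2 (Finset.mem_range.2 (Nat.lt_succ_of_le (Finset.card_filter_le _ _)))
    · intro C hC C' hC' heq
      obtain ⟨p, hpC, hp⟩ := hf C hC
      obtain ⟨q, hqC, hq⟩ := hf C' hC'
      rw [← hpC, ← hqC]
      refine mk_eq_mk_of_card_roots_lt_eq hF p q (by rw [hp, hq]) ?_
      rw [hp, hq]
      exact heq
  have htotal : R.card + _ ≤ _ := card_realRoots_add_two_mul_card_upperRoots_le
    (hF.map (evalRingHom x)).ne_zero
  rw [hF.natDegree_map] at htotal
  rw [Finset.card_range] at hle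
  omega

open Filter Topology Matrix in
theorem two_mul_card_le (hF : F.Monic)
    (H : Matrix (Fin F.natDegree) (Fin F.natDegree) (Polynomial ℝ)) (hH : H.IsSymm)
    (hdet : H.det ≠ 0) (hdeg : H.det.natDegree ≤ F.natDegree * (F.natDegree - 1))
    (hA : ∀ (x : ℝ) (v : Fin F.natDegree → ℝ) (i : Fin F.natDegree),
      (((H.map (eval x) *ᵥ v) i : ℝ) : ℂ) =
        (((F.map (evalRingHom x)).aroots ℂ).map fun w => w ^ (i : ℕ) * polyValue v w).sum)
    (𝒞 : Finset (ConnectedComponents F.CurveCompl)) :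
    2 * 𝒞.card ≤ 2 * (F.natDegree + 1) + F.natDegree * (F.natDegree - 1) := by
  classical
  have hlower : ∀ C : ConnectedComponents F.CurveCompl, ∃ o : Option ℝ,
      o.elim (∀ᶠ x in atBot, x ∈ shadow C) fun x₀ =>
        x₀ ∉ shadow C ∧ ∀ᶠ x in 𝓝[>] x₀, x ∈ shadow C := by
    intro C
    rcases (ordConnected_shadow C).eventually_atBot_or_nhdsGT (isOpen_shadow C)
      (shadow_nonempty C) with h | ⟨x₀, h⟩
    exacts [⟨none, h⟩, ⟨some x₀, h⟩]
  have hupper : ∀ C : ConnectedComponents F.CurveCompl, ∃ o : Option ℝ,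
      o.elim (∀ᶠ x in atTop, x ∈ shadow C) fun x₀ =>
        x₀ ∉ shadow C ∧ ∀ᶠ x in 𝓝[<] x₀, x ∈ shadow C := by
    intro C
    rcases (ordConnected_shadow C).eventually_atTop_or_nhdsLT (isOpen_shadow C)
      (shadow_nonempty C) with h | ⟨x₀, h⟩
    exacts [⟨none, h⟩, ⟨some x₀, h⟩]
  choose lo hlo using hlower
  choose hi hhi using hupper
  set S : Finset ℝ := Finset.eraseNone (𝒞.image lo ∪ 𝒞.image hi) with hS
  have hmem : ∀ o ∈ 𝒞.image lo ∪ 𝒞.image hi, o ∈ Finset.insertNone S := by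
    intro o ho
    cases o with
    | none => exact Finset.none_mem_insertNone
    | some x => exact Finset.some_mem_insertNone.2 (Finset.mem_eraseNone.2 ho)
  have hcardlo : 𝒞.card = ∑ o ∈ Finset.insertNone S, {C ∈ 𝒞 | lo C = o}.card :=
    Finset.card_eq_sum_card_fiberwise fun C hC =>
      hmem _ (Finset.mem_union_left _ (Finset.mem_image_of_mem _ hC))
  have hcardhi : 𝒞.card = ∑ o ∈ Finset.insertNone S, {C ∈ 𝒞 | hi C = o}.card :=
    Finset.card_eq_sum_card_fiberwise fun C hC =>
      hmem _ (Finset.mem_union_right _ (Finset.mem_image_of_mem _ hC))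
  rw [Finset.sum_insertNone] at hcardlo hcardhi
  have hbot : {C ∈ 𝒞 | lo C = none}.card ≤ F.natDegree + 1 := by
    have hev : ∀ᶠ x in atBot, ∀ C ∈ {C ∈ 𝒞 | lo C = none}, x ∈ shadow C := by
      refine (Filter.eventually_all_finset _).2 fun C hC => ?_
      have := hlo C
      rwa [(Finset.mem_filter.1 hC).2] at this
    obtain ⟨x, hx⟩ := hev.exists
    exact card_le_of_forall_mem_shadow hF x _ hx
  have htop : {C ∈ 𝒞 | hi C = none}.card ≤ F.natDegree + 1 := by
    have hev : ∀ᶠ x in atTop, ∀ C ∈ {C ∈ 𝒞 | hi C = none}, x ∈ shadow C := by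
      refine (Filter.eventually_all_finset _).2 fun C hC => ?_
      have := hhi C
      rwa [(Finset.mem_filter.1 hC).2] at this
    obtain ⟨x, hx⟩ := hev.exists
    exact card_le_of_forall_mem_shadow hF x _ hx
  have hmid : ∀ x₀, {C ∈ 𝒞 | lo C = some x₀}.card + {C ∈ 𝒞 | hi C = some x₀}.card ≤
      H.det.roots.count x₀ := by
    intro x₀
    have hevlo : ∀ᶠ x in 𝓝[>] x₀, ∀ C ∈ {C ∈ 𝒞 | lo C = some x₀}, x ∈ shadow C ∧
        x₀ ∉ shadow C := by
      refine (Filter.eventually_all_finset _).2 fun C hC => ?_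
      have := hlo C
      rw [(Finset.mem_filter.1 hC).2] at this
      exact this.2.mono fun x hx => ⟨hx, this.1⟩
    have hevhi : ∀ᶠ x in 𝓝[<] x₀, ∀ C ∈ {C ∈ 𝒞 | hi C = some x₀}, x ∈ shadow C ∧
        x₀ ∉ shadow C := by
      refine (Filter.eventually_all_finset _).2 fun C hC => ?_
      have := hhi C
      rw [(Finset.mem_filter.1 hC).2] at this
      exact this.2.mono fun x hx => ⟨hx, this.1⟩
    obtain ⟨x, ⟨hx, hxlo⟩, hxcard⟩ :=
      (((eventually_two_mul_natDegree_le F hF H hH hdet hA x₀).and hevlo).and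
        (nhdsWithin_le_nhds (eventually_card_add_le hF x₀))).exists
    obtain ⟨x', ⟨hx', hxhi⟩, hxcard'⟩ := ((hx.and hevhi).and
      (nhdsWithin_le_nhds (eventually_card_add_le hF x₀))).exists
    have h₁ := hxcard {C ∈ 𝒞 | lo C = some x₀} fun C hC =>
      ⟨(hxlo C hC).1, fun p hp hpx => (hxlo C hC).2 ⟨p, hp, hpx⟩⟩
    have h₂ := hxcard' {C ∈ 𝒞 | hi C = some x₀} fun C hC =>
      ⟨(hxhi C hC).1, fun p hp hpx => (hxhi C hC).2 ⟨p, hp, hpx⟩⟩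
    rw [count_roots]
    omega
  have hsum : ∑ x₀ ∈ S, ({C ∈ 𝒞 | lo C = some x₀}.card + {C ∈ 𝒞 | hi C = some x₀}.card) ≤
      F.natDegree * (F.natDegree - 1) := by
    refine (Finset.sum_le_sum fun x₀ _ => hmid x₀).trans (le_trans ?_ hdeg)
    refine le_trans ?_ (card_roots' _)
    refine le_trans ?_ (Multiset.toFinset_sum_count_eq H.det.roots).le
    refine Finset.sum_le_sum_of_ne_zero fun x₀ _ h => ?_
    exact Multiset.mem_toFinset.2 (Multiset.count_ne_zero.1 h)
  rw [Finset.sum_add_distrib] at hsum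
  omega

end Polynomial.CurveCompl

theorem Nat.card_le_of_forall_finset_card_le {α : Type*} {N : ℕ} (h : ∀ s : Finset α, s.card ≤ N) :
    Finite α ∧ Nat.card α ≤ N := by
  have hfin : Finite α := by
    by_contra hinf
    rw [not_finite_iff_infinite] at hinf
    obtain ⟨s, hs⟩ := Infinite.exists_subset_card_eq α (N + 1)
    exact absurd (h s) (by omega)
  refine ⟨hfin, ?_⟩
  have := Fintype.ofFinite α
  rw [Nat.card_eq_fintype_card]
  exact h Finset.univ

open Polynomial in
theorem Polynomial.Monic.squarefree_map_fractionRing {R : Type*} [CommRing R] [IsDomain R]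
    [IsIntegrallyClosed R] {f : R[X]} (hf : f.Monic) (hsq : Squarefree f) :
    Squarefree (f.map (algebraMap R (FractionRing R))) := by
  intro p hp
  have hne : p ≠ 0 := by
    rintro rfl
    exact (hf.map (algebraMap R (FractionRing R))).ne_zero (by simpa using hp)
  have hlead : p.leadingCoeff ≠ 0 := leadingCoeff_ne_zero.2 hne
  obtain ⟨g, hg⟩ := IsIntegrallyClosed.eq_map_mul_C_of_dvd (FractionRing R) hf
    ((dvd_mul_right p p).trans hp)
  have hunit : IsUnit (C p.leadingCoeff) := isUnit_C.2 hlead.isUnit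
  have hassoc : Associated (g.map (algebraMap R (FractionRing R))) p :=
    ⟨hunit.unit, hg⟩
  have hgmonic : g.Monic := by
    refine (IsFractionRing.injective R (FractionRing R)).monic_map_iff.2 ?_
    have := congrArg Polynomial.leadingCoeff hg
    rw [leadingCoeff_mul, leadingCoeff_C] at this
    exact mul_right_cancel₀ hlead (this.trans (one_mul _).symm)
  have hdvd : g * g ∣ f := by
    refine Monic.dvd_of_fraction_map_dvd_fraction_map (K := FractionRing R) hf
      (hgmonic.mul hgmonic) ?_
    rw [Polynomial.map_mul]
    exact ((hassoc.mul_mul hassoc).dvd_iff_dvd_left).2 hp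
  exact hassoc.isUnit ((hsq g hdvd).map (mapRingHom (algebraMap R (FractionRing R))))

open Polynomial in
theorem Polynomial.exists_separable_map_evalRingHom (F : Polynomial (Polynomial ℝ)) (hF : F.Monic)
    (hsq : Squarefree F) : ∃ x, (F.map (evalRingHom x)).Separable := by
  have hsep := PerfectField.separable_iff_squarefree.2 (hF.squarefree_map_fractionRing hsq)
  obtain ⟨a, b, hab⟩ := hsep
  obtain ⟨c, hc, ha⟩ := IsLocalization.integerNormalization_spec (nonZeroDivisors ℝ[X]) a
  obtain ⟨d, hd, hb⟩ := IsLocalization.integerNormalization_spec (nonZeroDivisors ℝ[X]) b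
  set a' := IsLocalization.integerNormalization (nonZeroDivisors ℝ[X]) a
  set b' := IsLocalization.integerNormalization (nonZeroDivisors ℝ[X]) b
  have hcomb : C d * a' * F + C c * b' * derivative F = C (c * d) := by
    refine map_injective (algebraMap ℝ[X] (FractionRing ℝ[X])) (IsFractionRing.injective _ _) ?_
    rw [derivative_map] at hab
    simp only [Polynomial.map_add, Polynomial.map_mul, map_C, ha, hb]
    rw [Algebra.smul_def, Algebra.smul_def, map_mul, C_mul]
    simp only [IsScalarTower.algebraMap_apply ℝ[X] (FractionRing ℝ[X]) (FractionRing ℝ[X])[X],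
      algebraMap_eq]
    linear_combination C (algebraMap ℝ[X] (FractionRing ℝ[X]) c) *
      C (algebraMap ℝ[X] (FractionRing ℝ[X]) d) * hab
  have hcd : c * d ≠ 0 := mul_ne_zero (nonZeroDivisors.ne_zero hc) (nonZeroDivisors.ne_zero hd)
  obtain ⟨x, hx⟩ : ∃ x, (c * d).eval x ≠ 0 := by
    by_contra! h
    exact hcd (Polynomial.funext fun x => by simp [h x])
  refine ⟨x, C ((c * d).eval x)⁻¹ * (C d * a').map (evalRingHom x),
    C ((c * d).eval x)⁻¹ * (C c * b').map (evalRingHom x), ?_⟩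
  rw [derivative_map, mul_assoc, mul_assoc, ← mul_add, ← Polynomial.map_mul, ← Polynomial.map_mul,
    ← Polynomial.map_add, hcomb, map_C, coe_evalRingHom, ← C_mul, inv_mul_cancel₀ hx, C_1]

open Matrix in
theorem det_ne_zero_of_hermite_of_separable {n : ℕ} (A : Matrix (Fin n) (Fin n) ℝ)
    (p : Polynomial ℝ) (hp : p.Separable) (hn : p.natDegree = n)
    (hA : ∀ (v : Fin n → ℝ) (i : Fin n), (((A *ᵥ v) i : ℝ) : ℂ) =
      ((p.aroots ℂ).map fun w => w ^ (i : ℕ) * polyValue v w).sum) : A.det ≠ 0 := by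
  intro hdet
  obtain ⟨v, hv, hAv⟩ := Matrix.exists_mulVec_eq_zero_iff.2 hdet
  have hcard : (p.aroots ℂ).card = n := by
    rw [← hn, ← Polynomial.natDegree_map (p := p) (algebraMap ℝ ℂ)]
    exact Polynomial.splits_iff_card_roots.1 (IsAlgClosed.splits _)
  obtain ⟨f, hf⟩ := (p.aroots ℂ).exists_fin_map_eq hcard
  have hinj : Function.Injective f := by
    have hnodup : ((Finset.univ : Finset (Fin n)).val.map f).Nodup := by
      rw [hf]
      exact (Polynomial.nodup_aroots_iff_of_splits hp.ne_zero (IsAlgClosed.splits _)).2 hp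
    exact fun i j h => Multiset.inj_on_of_nodup_map hnodup i (Finset.mem_univ_val i)
      j (Finset.mem_univ_val j) h
  have hzero : (fun j => polyValue v (f j)) = 0 := by
    refine Matrix.eq_zero_of_forall_pow_sum_mul_pow_eq_zero hinj fun i => ?_
    have := hA v i
    rw [hAv, ← hf, Multiset.map_map] at this
    calc ∑ j, polyValue v (f j) * f j ^ (i : ℕ) = ∑ j, f j ^ (i : ℕ) * polyValue v (f j) :=
          Finset.sum_congr rfl fun j _ => mul_comm _ _
      _ = 0 := this.symm.trans (by simp)
  have hv' : (fun j => (v j : ℂ)) = 0 :=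
    Matrix.eq_zero_of_forall_index_sum_mul_pow_eq_zero hinj fun j => congrFun hzero j
  exact hv (funext fun j => by simpa using congrFun hv' j)

open Polynomial in
theorem Polynomial.CurveCompl.finite_and_card_connectedComponents_le {F : Polynomial (Polynomial ℝ)}
    (hF : F.Monic) (hsq : Squarefree F)
    (hdeg : ∀ j d, F.natDegree < j + d → (F.coeff j).coeff d = 0) :
    Finite (ConnectedComponents F.CurveCompl) ∧
      Nat.card (ConnectedComponents F.CurveCompl) ≤ F.natDegree * (F.natDegree + 1) / 2 + 1 := by
  obtain ⟨H, hsymm, hdetdeg, hA⟩ := exists_hermite_matrix F hF hdeg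
  obtain ⟨x, hx⟩ := F.exists_separable_map_evalRingHom hF hsq
  have hdet : H.det ≠ 0 := by
    intro h
    refine det_ne_zero_of_hermite_of_separable (H.map (eval x)) _ hx (hF.natDegree_map _) (hA x) ?_
    have := RingHom.map_det (evalRingHom x) H
    rw [h, map_zero] at this
    exact this.symm
  refine Nat.card_le_of_forall_finset_card_le fun 𝒞 => ?_
  have h := two_mul_card_le hF H hsymm hdet hdetdeg hA 𝒞
  have hn : 2 * F.natDegree + F.natDegree * (F.natDegree - 1) =
      F.natDegree * (F.natDegree + 1) := by
    cases F.natDegree with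
    | zero => rfl
    | succ m => rw [Nat.add_sub_cancel]; ring
  omega

open Polynomial in
theorem Polynomial.coeff_coeff_mul_eq_zero {R : Type*} [CommRing R] {P Q : R[X][X]} {M N : ℕ}
    (hP : ∀ j d, M < j + d → (P.coeff j).coeff d = 0)
    (hQ : ∀ j d, N < j + d → (Q.coeff j).coeff d = 0) (j d : ℕ) (h : M + N < j + d) :
    ((P * Q).coeff j).coeff d = 0 := by
  rw [coeff_mul, finsetSum_coeff]
  refine Finset.sum_eq_zero fun a ha => ?_
  rw [coeff_mul]
  refine Finset.sum_eq_zero fun b hb => ?_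
  rw [Finset.HasAntidiagonal.mem_antidiagonal] at ha hb
  by_cases hM : M < a.1 + b.1
  · rw [hP _ _ hM, zero_mul]
  · rw [hQ _ _ (by omega), mul_zero]

open Polynomial in
theorem Polynomial.coeff_coeff_pow_eq_zero {R : Type*} [CommRing R] {P : R[X][X]} {M : ℕ}
    (hP : ∀ j d, M < j + d → (P.coeff j).coeff d = 0) (k j d : ℕ) (h : k * M < j + d) :
    ((P ^ k).coeff j).coeff d = 0 := by
  induction k generalizing j d with
  | zero =>
    rw [pow_zero, coeff_one]
    split_ifs with hj
    · rw [coeff_one, if_neg (by omega)]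
    · rw [coeff_zero]
  | succ k ih =>
    rw [pow_succ]
    exact coeff_coeff_mul_eq_zero ih hP j d (by rwa [Nat.succ_mul] at h)

namespace MvPolynomial

open Polynomial in
/-- Reading a polynomial in two variables as a polynomial in `y` over polynomials in `x`,
after the linear change of coordinates `(x, y) ↦ (x + c y, y)`. -/
noncomputable def sheared (c : ℝ) : MvPolynomial (Fin 2) ℝ →+* ℝ[X][X] :=
  eval₂Hom (Polynomial.C.comp Polynomial.C)
    ![Polynomial.C Polynomial.X + Polynomial.C (Polynomial.C c) * Polynomial.X, Polynomial.X]

open Polynomial in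
/-- The inverse of `MvPolynomial.sheared`. -/
noncomputable def unsheared (c : ℝ) : ℝ[X][X] →+* MvPolynomial (Fin 2) ℝ :=
  Polynomial.eval₂RingHom
    (Polynomial.eval₂RingHom (C : ℝ →+* MvPolynomial (Fin 2) ℝ) (X 0 - C c * X 1)) (X 1)

theorem unsheared_sheared (c : ℝ) (g : MvPolynomial (Fin 2) ℝ) :
    unsheared c (sheared c g) = g := by
  have : (unsheared c).comp (sheared c) = RingHom.id _ := by
    refine ringHom_ext (fun r => ?_) fun i => ?_
    · simp [sheared, unsheared]
    · fin_cases i <;> simp [sheared, unsheared]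
  exact congrArg (fun φ => φ g) this

theorem sheared_unsheared (c : ℝ) (P : Polynomial (Polynomial ℝ)) :
    sheared c (unsheared c P) = P := by
  have : (sheared c).comp (unsheared c) = RingHom.id _ := by
    refine Polynomial.ringHom_ext' (Polynomial.ringHom_ext' ?_ ?_) ?_
    · ext r : 1
      simp [sheared, unsheared]
    · simp [sheared, unsheared]
    · simp [sheared, unsheared]
  exact congrArg (fun φ => φ P) this

theorem squarefree_sheared (c : ℝ) {g : MvPolynomial (Fin 2) ℝ} (hg : Squarefree g) :
    Squarefree (sheared c g) := by
  intro p hp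
  have h := map_dvd (unsheared c) hp
  rw [map_mul, unsheared_sheared] at h
  rw [← sheared_unsheared c p]
  exact (hg _ h).map (sheared c)

theorem eval_map_sheared (c x y : ℝ) (g : MvPolynomial (Fin 2) ℝ) :
    ((sheared c g).map (Polynomial.evalRingHom x)).eval y = eval ![x + c * y, y] g := by
  have : ((Polynomial.evalRingHom y).comp (Polynomial.mapRingHom (Polynomial.evalRingHom x))).comp
      (sheared c) = eval ![x + c * y, y] := by
    refine ringHom_ext (fun r => ?_) fun i => ?_
    · simp [sheared]
    · fin_cases i <;> simp [sheared]
  exact congrArg (fun φ => φ g) this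

theorem sheared_monomial (c : ℝ) (m : Fin 2 →₀ ℕ) (a : ℝ) :
    sheared c (monomial m a) = Polynomial.C (Polynomial.C a) *
      ((Polynomial.C Polynomial.X + Polynomial.C (Polynomial.C c) * Polynomial.X) ^ m 0 *
        Polynomial.X ^ m 1) := by
  simp [sheared, eval₂Hom_monomial, Finsupp.prod_fintype]

theorem coeff_coeff_sheared_eq_zero (c : ℝ) (g : MvPolynomial (Fin 2) ℝ) (j d : ℕ)
    (h : g.totalDegree < j + d) : ((sheared c g).coeff j).coeff d = 0 := by
  rw [g.as_sum, map_sum, Polynomial.finsetSum_coeff, Polynomial.finsetSum_coeff]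
  refine Finset.sum_eq_zero fun m hm => ?_
  have hdeg := le_totalDegree hm
  rw [Finsupp.sum_fintype _ _ fun _ => rfl, Fin.sum_univ_two] at hdeg
  rw [sheared_monomial, Polynomial.coeff_C_mul, Polynomial.coeff_C_mul]
  refine mul_eq_zero_of_right _ (Polynomial.coeff_coeff_mul_eq_zero (M := m 0 * 1) (N := m 1 * 1)
    (Polynomial.coeff_coeff_pow_eq_zero ?_ _) (Polynomial.coeff_coeff_pow_eq_zero ?_ _) j d
    (by omega))
  · intro j d h
    rw [Polynomial.coeff_add, Polynomial.coeff_C, Polynomial.coeff_C_mul_X, Polynomial.coeff_add]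
    have h₁ : (if j = 0 then (Polynomial.X : Polynomial ℝ) else 0).coeff d = 0 := by
      split_ifs
      · exact Polynomial.coeff_X_of_ne_one (by omega)
      · simp
    have h₂ : (if j = 1 then (Polynomial.C c : Polynomial ℝ) else 0).coeff d = 0 := by
      split_ifs
      · exact Polynomial.coeff_C_of_ne_zero (by omega)
      · simp
    rw [h₁, h₂, add_zero]
  · intro j d h
    rw [Polynomial.coeff_X]
    split_ifs
    · rw [Polynomial.coeff_one, if_neg (by omega)]
    · simp

theorem exists_coeff_coeff_sheared_ne_zero {g : MvPolynomial (Fin 2) ℝ} (hg : g ≠ 0) :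
    ∃ c, ((sheared c g).coeff g.totalDegree).coeff 0 ≠ 0 := by
  set n := g.totalDegree with hn
  set q : Polynomial ℝ := ∑ m ∈ g.support with m 0 + m 1 = n,
    Polynomial.C (g.coeff m) * Polynomial.X ^ m 0 with hq
  have heval : ∀ c, ((sheared c g).coeff n).coeff 0 = q.eval c := by
    intro c
    conv_lhs => rw [g.as_sum]
    rw [map_sum, Polynomial.finsetSum_coeff, Polynomial.finsetSum_coeff, hq,
      Polynomial.eval_finsetSum, Finset.sum_filter]
    refine Finset.sum_congr rfl fun m _ => ?_
    rw [sheared_monomial, Polynomial.coeff_zero_eq_eval_zero, ← Polynomial.coe_evalRingHom,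
      ← Polynomial.coeff_map]
    simp only [Polynomial.map_mul, Polynomial.map_pow, Polynomial.map_add, Polynomial.map_C,
      Polynomial.map_X, Polynomial.coe_evalRingHom, Polynomial.eval_C, Polynomial.eval_X,
      Polynomial.C_0, zero_add, mul_pow, Polynomial.eval_mul, Polynomial.eval_pow]
    rw [mul_assoc, ← pow_add, ← Polynomial.C_pow, Polynomial.coeff_C_mul, Polynomial.coeff_C_mul,
      Polynomial.coeff_X_pow]
    simp [eq_comm]
  have hq0 : q ≠ 0 := by
    obtain ⟨m, hm, hmn⟩ := Finset.exists_mem_eq_sup g.support (support_nonempty.2 hg)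
      fun m => m.sum fun _ e => e
    rw [Finsupp.sum_fintype _ _ fun _ => rfl, Fin.sum_univ_two] at hmn
    have hmn' : m 0 + m 1 = n := hmn.symm
    intro h
    have hcoeff := congrArg (fun p => Polynomial.coeff p (m 0)) h
    simp only [hq, Polynomial.finsetSum_coeff, Polynomial.coeff_C_mul_X_pow,
      Polynomial.coeff_zero] at hcoeff
    rw [Finset.sum_eq_single m] at hcoeff
    · rw [if_pos rfl] at hcoeff
      exact mem_support_iff.1 hm hcoeff
    · intro m' hm' hne
      refine if_neg fun h0 => hne ?_
      have := (Finset.mem_filter.1 hm').2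
      ext i
      fin_cases i <;> simp <;> omega
    · exact fun h' => absurd (Finset.mem_filter.2 ⟨hm, hmn'⟩) h'
  obtain ⟨c, hc⟩ : ∃ c, q.eval c ≠ 0 := by
    by_contra! h
    exact hq0 (Polynomial.funext fun x => by simp [h x])
  exact ⟨c, by rwa [heval]⟩

/-- A squarefree polynomial in two variables becomes monic in `y` after a linear change of
coordinates. -/
theorem exists_monic_sheared {g : MvPolynomial (Fin 2) ℝ} (hg : Squarefree g) :
    ∃ (c : ℝ) (F : Polynomial (Polynomial ℝ)), F.Monic ∧ Squarefree F ∧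
      F.natDegree = g.totalDegree ∧ (∀ j d, F.natDegree < j + d → (F.coeff j).coeff d = 0) ∧
      ∀ x y, (F.map (Polynomial.evalRingHom x)).eval y ≠ 0 ↔ eval ![x + c * y, y] g ≠ 0 := by
  obtain ⟨c, hc⟩ := exists_coeff_coeff_sheared_ne_zero hg.ne_zero
  set a := ((sheared c g).coeff g.totalDegree).coeff 0 with ha
  set F := Polynomial.C (Polynomial.C a⁻¹) * sheared c g with hFdef
  have hbound : ∀ j d, g.totalDegree < j + d → (F.coeff j).coeff d = 0 := by
    intro j d h
    rw [hFdef, Polynomial.coeff_C_mul, Polynomial.coeff_C_mul,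
      coeff_coeff_sheared_eq_zero c g j d h, mul_zero]
  have hcoeff : F.coeff g.totalDegree = 1 := by
    ext d
    cases d with
    | zero =>
      rw [hFdef, Polynomial.coeff_C_mul, Polynomial.coeff_C_mul, ← ha, inv_mul_cancel₀ hc,
        Polynomial.coeff_one_zero]
    | succ d => rw [hbound _ _ (by omega), Polynomial.coeff_one, if_neg (by omega)]
  have hle : F.natDegree ≤ g.totalDegree := by
    refine Polynomial.natDegree_le_iff_coeff_eq_zero.2 fun j hj => ?_
    ext d
    rw [hbound j d (by omega), Polynomial.coeff_zero]
  have hnat : F.natDegree = g.totalDegree :=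
    Polynomial.natDegree_eq_of_le_of_coeff_ne_zero hle (by rw [hcoeff]; exact one_ne_zero)
  have hunit : IsUnit (Polynomial.C (Polynomial.C a⁻¹)) :=
    ((inv_ne_zero hc).isUnit.map Polynomial.C).map Polynomial.C
  refine ⟨c, F, Polynomial.monic_of_natDegree_le_of_coeff_eq_one _ hle hcoeff, ?_, hnat,
    hnat ▸ hbound, fun x y => ?_⟩
  · exact fun p hp => squarefree_sheared c hg p (hunit.dvd_mul_left.1 hp)
  · rw [hFdef, Polynomial.map_mul, Polynomial.eval_mul, eval_map_sheared, Polynomial.map_C,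
      Polynomial.eval_C, Polynomial.coe_evalRingHom, Polynomial.eval_C]
    simp [hc]

theorem exists_squarefree_same_zeros {σ K : Type*} [Field K] (f : MvPolynomial σ K) (hf : f ≠ 0) :
    ∃ g : MvPolynomial σ K, Squarefree g ∧ g.totalDegree ≤ f.totalDegree ∧
      ∀ x, eval x g ≠ 0 ↔ eval x f ≠ 0 := by
  induction hn : f.totalDegree using Nat.strong_induction_on generalizing f with
  | _ n ih =>
    by_cases hsq : Squarefree f
    · exact ⟨f, hsq, hn.le, fun x => Iff.rfl⟩
    · obtain ⟨p, ⟨q, rfl⟩, hp⟩ : ∃ p, p * p ∣ f ∧ ¬IsUnit p := by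
        simpa [Squarefree] using hsq
      have hp0 : p ≠ 0 := by
        rintro rfl
        simp at hf
      have hq0 : q ≠ 0 := by
        rintro rfl
        simp at hf
      have hpos : 0 < p.totalDegree := by
        refine Nat.pos_of_ne_zero fun h => hp ?_
        rw [totalDegree_eq_zero_iff_eq_C] at h
        rw [h]
        refine (isUnit_iff_ne_zero.2 fun h0 => hp0 ?_).map C
        rw [h, h0, C_0]
      rw [totalDegree_mul_of_isDomain (mul_ne_zero hp0 hp0) hq0,
        totalDegree_mul_of_isDomain hp0 hp0] at hn
      have hpq := totalDegree_mul_of_isDomain hp0 hq0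
      obtain ⟨g, hg, hdeg, heval⟩ := ih (p * q).totalDegree (by omega) (p * q)
        (mul_ne_zero hp0 hq0) rfl
      refine ⟨g, hg, by omega, fun x => (heval x).trans ?_⟩
      simp

end MvPolynomial

/-- A nonzero polynomial in two real variables of total degree at most `k`
has at most `k(k+1)/2 + 1` nodal domains on `ℝ²`, i.e. the set where it does not vanish
has at most `k(k+1)/2 + 1` connected components. -/
theorem nodal_domains_of_polynomial_le
    (k : ℕ) (f : MvPolynomial (Fin 2) ℝ) (hf : f ≠ 0) (hdeg : f.totalDegree ≤ k) :
    Nat.card (ConnectedComponents {x : Fin 2 → ℝ // MvPolynomial.eval x f ≠ 0}) ≤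
      k * (k + 1) / 2 + 1 := by
  obtain ⟨g, hg, hgdeg, hgf⟩ := f.exists_squarefree_same_zeros hf
  obtain ⟨c, F, hF, hsq, hnat, hbound, heval⟩ := MvPolynomial.exists_monic_sheared hg
  obtain ⟨hfin, hcard⟩ := Polynomial.CurveCompl.finite_and_card_connectedComponents_le hF hsq hbound
  let Φ : F.CurveCompl → {x : Fin 2 → ℝ // MvPolynomial.eval x f ≠ 0} := fun p =>
    ⟨![p.1.1 + c * p.1.2, p.1.2], (hgf _).1 ((heval _ _).1 p.2)⟩
  have hΦ : Continuous Φ := by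
    refine Continuous.subtype_mk (continuous_pi fun i => ?_) _
    fin_cases i <;> simp <;> fun_prop
  have hsurj : Function.Surjective hΦ.connectedComponentsMap := by
    intro C
    obtain ⟨⟨x, hx⟩, rfl⟩ := ConnectedComponents.surjective_coe C
    have hx' : x = ![(x 0 - c * x 1) + c * x 1, x 1] := by
      ext i
      fin_cases i <;> simp
    refine ⟨ConnectedComponents.mk ⟨(x 0 - c * x 1, x 1), (heval _ _).2 ((hgf _).2 ?_)⟩, ?_⟩
    · rwa [← hx']
    · exact congrArg ConnectedComponents.mk (Subtype.ext hx'.symm)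
  have hle : F.natDegree ≤ k := hnat ▸ hgdeg.trans hdeg
  calc _ ≤ _ := Nat.card_le_card_of_surjective _ hsurj
    _ ≤ _ := hcard
    _ ≤ _ := by gcongr
end

section
/- Let 0 < b < 1, and let 𝒯 ⊂ ℝ² be the interior of the triangle with vertices A = (√3, 0), B = (0, b), C = (0, −b); write O = (0,0) and 𝒯₊ = 𝒯 ∩ {y > 0}. Let u : ℝ² → ℝ be a C¹ function satisfying: (i) u(x, −y) = u(x, y) for all (x,y); (ii) ∂u/∂x(p) < 0 for every p in the closure of 𝒯 not lying on the closed segment [B,C] and different from A; (iii) ∂u/∂y(p) > 0 for every p in the closure of 𝒯₊ not lying on the closed segment [O,A] and different from B; (iv) u(A) < 0 < u(O) = 1 < u(B). Then, denoting by β₀(u − a) the number of connected components of the set {p ∈ 𝒯 | u(p) ≠ a}: β₀(u − a) = 1 if a ≤ u(A) or a ≥ u(B); β₀(u − a) = 2 if u(A) < a < 1; and β₀(u − a) = 3 if 1 ≤ a < u(B). (These hypotheses hold for the second Neumann eigenfunction of the subequilateral triangle 𝒯, normalized by u(O) = 1, by the theorems of Laugesen–Siudeja and Miyamoto; hence for 1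 ≤ a < u(B) the function u − a is a linear combination of the first two Neumann eigenfunctions with 3 nodal domains, disproving the Extended Courant property for 𝒯.) -/
open Real

open Set Topology

/-- A set covered by finitely many pairwise disjoint, nonempty, preconnected open sets has exactly
as many connected components as there are sets in the cover. -/
theorem card_connectedComponents_of_iUnion {X : Type*} [TopologicalSpace X] {n : ℕ}
    {P : X → Prop} (U : Fin n → Set X) (hopen : ∀ i, IsOpen (U i))
    (hconn : ∀ i, IsPreconnected (U i)) (hne : ∀ i, (U i).Nonempty)
    (hdisj : ∀ i j x, x ∈ U i → x ∈ U j → i = j) (hcover : ∀ x, P x ↔ ∃ i, x ∈ U i) :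
    Nat.card (ConnectedComponents {x // P x}) = n := by
  choose f hf using fun x : {x // P x} => (hcover x).1 x.2
  have hcont : Continuous f := by
    refine IsLocallyConstant.continuous ((IsLocallyConstant.iff_exists_open f).2 fun x => ?_)
    exact ⟨Subtype.val ⁻¹' U (f x), (hopen _).preimage continuous_subtype_val, hf x,
      fun y hy => hdisj _ _ _ (hf y) hy⟩
  have hbij : Function.Bijective hcont.connectedComponentsLift := by
    constructor
    · intro c d
      obtain ⟨x, rfl⟩ := ConnectedComponents.surjective_coe c
      obtain ⟨y, rfl⟩ := ConnectedComponents.surjective_coe d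
      intro h
      simp only [Continuous.connectedComponentsLift_apply_coe] at h
      have hpre : IsPreconnected ((Subtype.val : {x // P x} → X) ⁻¹' U (f x)) := by
        have hind : Topology.IsInducing (Subtype.val : {x // P x} → X) := ⟨rfl⟩
        rw [← hind.isPreconnected_image, image_preimage_eq_of_subset]
        · exact hconn _
        · exact fun z hz => ⟨⟨z, (hcover z).2 ⟨_, hz⟩⟩, rfl⟩
      refine ConnectedComponents.coe_eq_coe'.2 ?_
      exact hpre.subset_connectedComponent (h ▸ hf y) (hf x)
    · intro i
      obtain ⟨x, hx⟩ := hne i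
      let z : {x // P x} := ⟨x, (hcover x).2 ⟨i, hx⟩⟩
      exact ⟨(z : ConnectedComponents {x // P x}), hdisj _ _ _ (hf z) hx⟩
  rw [Nat.card_eq_of_bijective _ hbij, Nat.card_fin]

theorem joinedIn_horizontal {S : Set (ℝ × ℝ)} {x x' y : ℝ} (h : x ≤ x')
    (hS : ∀ t ∈ Icc x x', (t, y) ∈ S) : JoinedIn S (x, y) (x', y) := by
  refine JoinedIn.of_segment_subset ?_
  rw [← Prod.image_mk_segment_left, segment_eq_Icc h]
  rintro _ ⟨t, ht, rfl⟩
  exact hS t ht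

theorem joinedIn_vertical {S : Set (ℝ × ℝ)} {x y y' : ℝ} (h : y ≤ y')
    (hS : ∀ t ∈ Icc y y', (x, t) ∈ S) : JoinedIn S (x, y) (x, y') := by
  refine JoinedIn.of_segment_subset ?_
  rw [← Prod.image_mk_segment_right, segment_eq_Icc h]
  rintro _ ⟨t, ht, rfl⟩
  exact hS t ht

theorem isPreconnected_of_joinedIn {X : Type*} [TopologicalSpace X] {S : Set X}
    (h : ∀ p ∈ S, ∀ q ∈ S, JoinedIn S p q) : IsPreconnected S := by
  rcases S.eq_empty_or_nonempty with rfl | hS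
  · exact isPreconnected_empty
  · exact (isPathConnected_iff.2 ⟨hS, h⟩).isConnected.isPreconnected

/-- The open isosceles triangle with apex `(b / k, 0)` and base `{0} × (-b, b)`. -/
def isoscelesTriangle (k b : ℝ) : Set (ℝ × ℝ) := {p | 0 < p.1 ∧ |p.2| + k * p.1 < b}

theorem isOpen_isoscelesTriangle (k b : ℝ) : IsOpen (isoscelesTriangle k b) :=
  (isOpen_lt continuous_const continuous_fst).inter 
    (isOpen_lt (f := fun p : ℝ × ℝ => |p.2| + k * p.1) (by fun_prop) continuous_const)

theorem convexHull_isosceles {k b c : ℝ} (hb : 0 < b) (hc : 0 < c) (hk : k * c = b) :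
    convexHull ℝ ({(c, 0), (0, b), (0, -b)} : Set (ℝ × ℝ)) =
      {p : ℝ × ℝ | 0 ≤ p.1 ∧ |p.2| + k * p.1 ≤ b} := by
  refine Subset.antisymm (convexHull_min ?_ ?_) ?_
  · rintro p (rfl | rfl | rfl) <;> simp [abs_of_pos hb, hk, hc.le]
  · rintro ⟨x, y⟩ ⟨h1, h2⟩ ⟨x', y'⟩ ⟨h3, h4⟩ s t hs ht hst
    simp only [← le_sub_iff_add_le, abs_le] at h2 h4
    simp only [mem_ofPred_eq, Prod.smul_mk, Prod.mk_add_mk, smul_eq_mul,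
      ← le_sub_iff_add_le, abs_le] at *
    refine ⟨by positivity, ?_, ?_⟩ <;>
      nlinarith [mul_nonneg hs (sub_nonneg.2 h2.1), mul_nonneg hs (sub_nonneg.2 h2.2),
        mul_nonneg ht (sub_nonneg.2 h4.1), mul_nonneg ht (sub_nonneg.2 h4.2)]
  · rintro ⟨x, y⟩ ⟨h1, h2⟩
    simp only [← le_sub_iff_add_le, abs_le] at h1 h2
    subst hk
    have hmem := (convex_convexHull ℝ ({(c, 0), (0, k * c), (0, -(k * c))} : Set (ℝ × ℝ))).sum_mem
      (t := Finset.univ) (w := ![x / c, (1 - x / c + y / (k * c)) / 2,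
        (1 - x / c - y / (k * c)) / 2])
      (z := ![(c, 0), (0, k * c), (0, -(k * c))]) ?_ ?_ ?_
    · convert hmem using 1
      have hk0 : k ≠ 0 := by rintro rfl; simp at hb
      simp only [Fin.sum_univ_three, Matrix.cons_val]
      ext <;> simp <;> field_simp
      ring
    · have e : 1 - x / c = (k * c - k * x) / (k * c) := by
        have hk0 : k ≠ 0 := by rintro rfl; simp at hb
        field_simp
      intro i _
      fin_cases i
      · exact div_nonneg h1 hc.le
      · simp only [Fin.mk_one, Matrix.cons_val]
        rw [e, ← add_div]
        exact div_nonneg (div_nonneg (by linarith) hb.le) (by norm_num)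
      · simp only [Fin.reduceFinMk, Matrix.cons_val]
        rw [e, ← sub_div]
        exact div_nonneg (div_nonneg (by linarith) hb.le) (by norm_num)
    · simp only [Fin.sum_univ_three, Matrix.cons_val]
      ring
    · intro i _
      apply subset_convexHull
      fin_cases i <;> simp

theorem interior_convexHull_isosceles {k b c : ℝ} (hb : 0 < b) (hc : 0 < c) (hk : k * c = b) :
    interior (convexHull ℝ ({(c, 0), (0, b), (0, -b)} : Set (ℝ × ℝ))) =
      isoscelesTriangle k b := by
  rw [convexHull_isosceles hb hc hk]
  refine Subset.antisymm ?_
    (interior_maximal (fun p hp => ⟨hp.1.le, hp.2.le⟩) (isOpen_isoscelesTriangle k b))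
  rintro ⟨x, y⟩ hp
  obtain ⟨ε, hε, hball⟩ := Metric.mem_nhds_iff.1 (mem_interior_iff_mem_nhds.1 hp)
  have key : ∀ x' y' : ℝ, |x' - x| < ε → |y' - y| < ε → 0 ≤ x' ∧ |y'| + k * x' ≤ b := by
    intro x' y' hx hy
    exact hball (a := (x', y')) (by
      rw [Metric.mem_ball, Prod.dist_eq, max_lt_iff, Real.dist_eq, Real.dist_eq]
      exact ⟨hx, hy⟩)
  have e0 : |(0 : ℝ)| < ε := by simpa using hε
  have e1 : |ε / 2| < ε := by rw [abs_of_pos (by positivity)]; linarith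
  have h1 := (key (x - ε / 2) y (by simpa using e1) (by simpa using hε)).1
  have h2 := (key x (y + ε / 2) (by simpa using hε) (by simpa using e1)).2
  have h3 := (key x (y - ε / 2) (by simpa using hε) (by simpa using e1)).2
  refine ⟨by dsimp only; linarith, ?_⟩
  dsimp only
  rcases abs_cases y with ⟨h, -⟩ | ⟨h, -⟩ <;> rw [h]
  · linarith [le_abs_self (y + ε / 2)]
  · linarith [neg_le_abs (y - ε / 2)]

theorem mem_closure_upper_isoscelesTriangle {k b : ℝ} (hkb : k < b)
    {y : ℝ} (hy : 0 < y) (hyb : y ≤ b) :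
    ((0, y) : ℝ × ℝ) ∈ closure (isoscelesTriangle k b ∩ {p | 0 < p.2}) := by
  have hlim : Filter.Tendsto (fun s : ℝ => ((s, (1 - s) * y) : ℝ × ℝ)) (𝓝[>] 0) (𝓝 (0, y)) := by
    have : ContinuousAt (fun s : ℝ => ((s, (1 - s) * y) : ℝ × ℝ)) 0 := by fun_prop
    simpa [ContinuousAt] using this.tendsto.mono_left nhdsWithin_le_nhds
  refine mem_closure_of_tendsto hlim ?_
  filter_upwards [Ioo_mem_nhdsGT (zero_lt_one (α := ℝ))] with s hs
  have h1 : 0 < (1 - s) * y := mul_pos (by linarith [hs.2]) hy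
  refine ⟨⟨hs.1, ?_⟩, h1⟩
  simp only [abs_of_pos h1]
  nlinarith [hs.1, hs.2, mul_pos hs.1 (sub_pos.2 hkb),
    mul_nonneg (sub_pos.2 hs.2).le (sub_nonneg.2 hyb)]

section LevelSets

variable {k b : ℝ} {u : ℝ × ℝ → ℝ}

theorem isPreconnected_sublevel (hk : 0 < k)
    (hx : ∀ x x' y, 0 ≤ x → x ≤ x' → |y| + k * x' ≤ b → u (x', y) ≤ u (x, y))
    (hy : ∀ x y y', 0 ≤ x → |y| ≤ |y'| → |y'| + k * x ≤ b → u (x, y) ≤ u (x, y')) (a : ℝ) :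
    IsPreconnected (isoscelesTriangle k b ∩ {p | u p < a}) := by
  set S := isoscelesTriangle k b ∩ {p | u p < a} with hS
  have vert : ∀ x y, (x, y) ∈ S → ∀ t, |t| ≤ |y| → (x, t) ∈ S := by
    rintro x y ⟨⟨h1, h2⟩, h3⟩ t ht
    dsimp only at h1 h2
    exact ⟨⟨h1, by dsimp only; linarith⟩, (hy x t y h1.le ht h2.le).trans_lt h3⟩
  have vjoin : ∀ x y, (x, y) ∈ S → JoinedIn S (x, y) (x, 0) := by
    intro x y h
    rcases le_total 0 y with h0 | h0
    · refine (joinedIn_vertical h0 fun t ht => vert x y h t ?_).symm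
      rw [abs_of_nonneg ht.1, abs_of_nonneg h0]; exact ht.2
    · refine joinedIn_vertical h0 fun t ht => vert x y h t ?_
      rw [abs_of_nonpos ht.2, abs_of_nonpos h0]; linarith [ht.1]
  have hjoin : ∀ x x', (x, 0) ∈ S → (x', 0) ∈ S → x ≤ x' → JoinedIn S (x, 0) (x', 0) := by
    rintro x x' ⟨⟨h1, h2⟩, h3⟩ ⟨⟨h4, h5⟩, h6⟩ hle
    dsimp only at h1 h2 h4 h5
    refine joinedIn_horizontal hle fun t ht => ?_
    have h7 : |0| + k * t < b := by nlinarith [ht.2]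
    exact ⟨⟨h1.trans_le ht.1, h7⟩, (hx x t 0 h1.le ht.1 h7.le).trans_lt h3⟩
  refine isPreconnected_of_joinedIn ?_
  rintro ⟨x, y⟩ hp ⟨x', y'⟩ hq
  have hp0 := vert x y hp 0 (by simp)
  have hq0 := vert x' y' hq 0 (by simp)
  refine (vjoin x y hp).trans (JoinedIn.trans ?_ (vjoin x' y' hq).symm)
  rcases le_total x x' with h | h
  · exact hjoin x x' hp0 hq0 h
  · exact (hjoin x' x hq0 hp0 h).symm

theorem isPreconnected_upper_superlevel (hk : 0 < k)
    (hx : ∀ x x' y, 0 ≤ x → x ≤ x' → |y| + k * x' ≤ b → u (x', y) ≤ u (x, y))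
    (hy : ∀ x y y', 0 ≤ x → |y| ≤ |y'| → |y'| + k * x ≤ b → u (x, y) ≤ u (x, y')) (a : ℝ) :
    IsPreconnected (isoscelesTriangle k b ∩ {p | 0 < p.2 ∧ a < u p}) := by
  set S := isoscelesTriangle k b ∩ {p | 0 < p.2 ∧ a < u p} with hS
  have left : ∀ x y, (x, y) ∈ S → ∀ t, 0 < t → t ≤ x → (t, y) ∈ S := by
    rintro x y ⟨⟨h1, h2⟩, h3, h4⟩ t ht htx
    dsimp only at h1 h2
    exact ⟨⟨ht, by dsimp only; nlinarith⟩, h3, h4.trans_le (hx t x y ht.le htx h2.le)⟩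
  have vjoin : ∀ x y y', (x, y) ∈ S → (x, y') ∈ S → y ≤ y' → JoinedIn S (x, y) (x, y') := by
    rintro x y y' ⟨⟨h1, h2⟩, h3, h4⟩ ⟨⟨h5, h6⟩, h7, h8⟩ hle
    dsimp only at h1 h2 h3 h5 h6 h7
    refine joinedIn_vertical hle fun t ht => ?_
    have h0 : 0 < t := h3.trans_le ht.1
    have h9 : |t| + k * x < b := by
      rw [abs_of_pos h0]; rw [abs_of_pos h7] at h6; linarith [ht.2]
    refine ⟨⟨h1, h9⟩, h0, h4.trans_le (hy x y t h1.le ?_ h9.le)⟩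
    rw [abs_of_pos h0, abs_of_pos h3]; exact ht.1
  have main : ∀ x y x' y', (x, y) ∈ S → (x', y') ∈ S → x ≤ x' →
      JoinedIn S (x, y) (x', y') := by
    intro x y x' y' hp hq hle
    have hx0 : 0 < x := hp.1.1
    have hm := left x' y' hq x hx0 hle
    refine JoinedIn.trans ?_ (joinedIn_horizontal hle fun t ht =>
      left x' y' hq t (hx0.trans_le ht.1) ht.2)
    rcases le_total y y' with h | h
    · exact vjoin x y y' hp hm h
    · exact (vjoin x y' y hm hp h).symm
  refine isPreconnected_of_joinedIn ?_
  rintro ⟨x, y⟩ hp ⟨x', y'⟩ hq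
  rcases le_total x x' with h | h
  · exact main x y x' y' hp hq h
  · exact (main x' y' x y hq hp h).symm

theorem isPreconnected_superlevel (hk : 0 < k)
    (hx : ∀ x x' y, 0 ≤ x → x ≤ x' → |y| + k * x' ≤ b → u (x', y) ≤ u (x, y))
    (hy : ∀ x y y', 0 ≤ x → |y| ≤ |y'| → |y'| + k * x ≤ b → u (x, y) ≤ u (x, y')) {a ε : ℝ}
    (hε : 0 < ε) (hεb : k * ε < b) (ha : a < u (ε, 0)) :
    IsPreconnected (isoscelesTriangle k b ∩ {p | a < u p}) := by
  set S := isoscelesTriangle k b ∩ {p | a < u p} with hS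
  have join : ∀ p ∈ S, JoinedIn S p (ε, 0) := by
    rintro ⟨x, y⟩ ⟨⟨h1, h2⟩, h3⟩
    dsimp only [mem_ofPred_eq] at h1 h2 h3
    set m := min x ε with hm
    have hm0 : 0 < m := lt_min h1 hε
    have hmx : m ≤ x := min_le_left _ _
    have hmε : m ≤ ε := min_le_right _ _
    have hmem : ∀ t, |t| ≤ |y| → (m, t) ∈ S := by
      intro t ht
      have h4 : |t| + k * m < b := by nlinarith
      have h5 := hx m ε 0 hm0.le hmε (by simpa using hεb.le)
      have h6 := hy m 0 t hm0.le (by simp) h4.le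
      exact ⟨⟨hm0, h4⟩, ha.trans_le (h5.trans h6)⟩
    have j1 : JoinedIn S (m, y) (x, y) := joinedIn_horizontal hmx fun t ht =>
      ⟨⟨hm0.trans_le ht.1, by dsimp only; nlinarith [ht.2]⟩,
        h3.trans_le (hx t x y (hm0.le.trans ht.1) ht.2 h2.le)⟩
    have j2 : JoinedIn S (m, y) (m, 0) := by
      rcases le_total 0 y with h0 | h0
      · refine (joinedIn_vertical h0 fun t ht => hmem t ?_).symm
        rw [abs_of_nonneg ht.1, abs_of_nonneg h0]; exact ht.2
      · refine joinedIn_vertical h0 fun t ht => hmem t ?_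
        rw [abs_of_nonpos ht.2, abs_of_nonpos h0]; linarith [ht.1]
    have j3 : JoinedIn S (m, 0) (ε, 0) := joinedIn_horizontal hmε fun t ht =>
      ⟨⟨hm0.trans_le ht.1, by simp only [abs_zero]; nlinarith [ht.2]⟩,
        ha.trans_le (hx t ε 0 (hm0.le.trans ht.1) ht.2 (by simpa using hεb.le))⟩
    exact j1.symm.trans (j2.trans j3)
  exact isPreconnected_of_joinedIn fun p hp q hq => (join p hp).trans (join q hq).symm

end LevelSets

theorem strictAntiOn_horizontal {u : ℝ × ℝ → ℝ} (hu : Differentiable ℝ u) {x x' y : ℝ}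
    (h : ∀ t ∈ Ioo x x', fderiv ℝ u (t, y) (1, 0) < 0) :
    StrictAntiOn (fun t => u (t, y)) (Icc x x') := by
  refine strictAntiOn_of_deriv_neg (convex_Icc x x')
    (hu.continuous.comp (by fun_prop)).continuousOn fun t ht => ?_
  rw [interior_Icc] at ht
  have hd : HasDerivAt (fun t : ℝ => ((t, y) : ℝ × ℝ)) (1, 0) t :=
    (hasDerivAt_id t).prodMk (hasDerivAt_const t y)
  exact ((hu (t, y)).hasFDerivAt.comp_hasDerivAt t hd).deriv.trans_lt (h t ht)

theorem strictMonoOn_vertical {u : ℝ × ℝ → ℝ} (hu : Differentiable ℝ u) {x y y' : ℝ}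
    (h : ∀ t ∈ Ioo y y', 0 < fderiv ℝ u (x, t) (0, 1)) :
    StrictMonoOn (fun t => u (x, t)) (Icc y y') := by
  refine strictMonoOn_of_deriv_pos (convex_Icc y y')
    (hu.continuous.comp (by fun_prop)).continuousOn fun t ht => ?_
  rw [interior_Icc] at ht
  have hd : HasDerivAt (fun t : ℝ => ((x, t) : ℝ × ℝ)) (0, 1) t :=
    (hasDerivAt_const t x).prodMk (hasDerivAt_id t)
  exact (h t ht).trans_eq ((hu (x, t)).hasFDerivAt.comp_hasDerivAt t hd).deriv.symm

/-- (Level-domain count for the second Neumann eigenfunction of a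
subequilateral triangle.) Let `0 < b < 1`, `𝒯` the open triangle with vertices
`A = (√3,0)`, `B = (0,b)`, `C = (0,−b)`, `O = (0,0)`, `𝒯₊ = 𝒯 ∩ {y > 0}`. If `u` is `C¹`,
even in `y`, with `∂u/∂x < 0` on `closure 𝒯 ∖ ([B,C] ∪ {A})`, `∂u/∂y > 0` on
`closure 𝒯₊ ∖ ([O,A] ∪ {B})`, and `u(A) < 0 < u(O) = 1 < u(B)`, then the number of
connected components of `{p ∈ 𝒯 | u(p) ≠ a}` is `1` for `a ≤ u(A)` or `a ≥ u(B)`,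
`2` for `u(A) < a < 1`, and `3` for `1 ≤ a < u(B)`. -/
theorem subequilateral_triangle_level_domains
    (b : ℝ) (hb0 : 0 < b) (hb1 : b < 1)
    (u : ℝ × ℝ → ℝ) (hu : ContDiff ℝ 1 u) :
    ∀ (A B C O : ℝ × ℝ), A = (Real.sqrt 3, 0) → B = (0, b) → C = (0, -b) → O = (0, 0) →
    ∀ T : Set (ℝ × ℝ), T = interior (convexHull ℝ ({A, B, C} : Set (ℝ × ℝ))) →
    ∀ Tp : Set (ℝ × ℝ), Tp = T ∩ {p : ℝ × ℝ | 0 < p.2} →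
    (∀ x y : ℝ, u (x, -y) = u (x, y)) →
    (∀ p ∈ closure T, p ∉ segment ℝ B C → p ≠ A → fderiv ℝ u p (1, 0) < 0) →
    (∀ p ∈ closure Tp, p ∉ segment ℝ O A → p ≠ B → 0 < fderiv ℝ u p (0, 1)) →
    u A < 0 → u O = 1 → 1 < u B →
    ∀ a : ℝ,
      ((a ≤ u A ∨ u B ≤ a) →
        Nat.card (ConnectedComponents {p : ℝ × ℝ // p ∈ T ∧ u p ≠ a}) = 1) ∧
      ((u A < a ∧ a < 1) →
        Nat.card (ConnectedComponents {p : ℝ × ℝ // p ∈ T ∧ u p ≠ a}) = 2) ∧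
      ((1 ≤ a ∧ a < u B) →
        Nat.card (ConnectedComponents {p : ℝ × ℝ // p ∈ T ∧ u p ≠ a}) = 3) := by
  rintro A B C O rfl rfl rfl rfl T rfl Tp rfl heven hux huy hA hO hB a
  have hs : 0 < √3 := by positivity
  obtain ⟨k, hk⟩ : ∃ k, k * √3 = b := ⟨b / √3, by field_simp⟩
  have hk0 : 0 < k := pos_of_mul_pos_left (hk ▸ hb0) hs.le
  have hs1 : 1 < √3 := by rw [Real.lt_sqrt] <;> norm_num
  have hkb : k < b := by nlinarith
  have hconv : Convex ℝ (isoscelesTriangle k b) :=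
    interior_convexHull_isosceles hb0 hs hk ▸ (convex_convexHull ℝ _).interior
  rw [interior_convexHull_isosceles hb0 hs hk] at *
  have hud : Differentiable ℝ u := hu.differentiable (by norm_num)
  have huc : Continuous u := hu.continuous
  have hx : ∀ x x' y, 0 ≤ x → x < x' → |y| + k * x' ≤ b → u (x', y) < u (x, y) := by
    intro x x' y hx0 hlt hle
    refine strictAntiOn_horizontal hud (fun t ht => ?_) (left_mem_Icc.2 hlt.le)
      (right_mem_Icc.2 hlt.le) hlt
    have ht0 : 0 < t := hx0.trans_lt ht.1
    have hmem : (t, y) ∈ isoscelesTriangle k b := ⟨ht0, by dsimp only; nlinarith [ht.2]⟩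
    refine hux _ (subset_closure hmem) ?_ ?_
    · rw [← Prod.image_mk_segment_right]
      rintro ⟨s, -, h⟩
      exact ht0.ne (congrArg Prod.fst h)
    · intro h
      obtain ⟨rfl, rfl⟩ := Prod.mk.inj h
      have := hmem.2
      simp [hk] at this
  have hy : ∀ x y y', 0 ≤ x → |y| ≤ |y'| → |y'| + k * x ≤ b → u (x, y) ≤ u (x, y') := by
    have habs : ∀ x y, u (x, |y|) = u (x, y) := fun x y => by
      rcases abs_choice y with h | h <;> rw [h]
      exact heven x y
    intro x y y' hx0 hle hb
    rw [← habs x y, ← habs x y']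
    refine (strictMonoOn_vertical hud fun t ht => ?_).monotoneOn (left_mem_Icc.2 hle)
      (right_mem_Icc.2 hle) hle
    have ht0 : 0 < t := (abs_nonneg y).trans_lt ht.1
    have hkx : 0 ≤ k * x := by positivity
    refine huy _ ?_ ?_ ?_
    · rcases hx0.eq_or_lt with rfl | hx0
      · exact mem_closure_upper_isoscelesTriangle hkb ht0 (by linarith [ht.2])
      · refine subset_closure ⟨⟨hx0, ?_⟩, ht0⟩
        simp only [abs_of_pos ht0]
        linarith [ht.2]
    · rw [← Prod.image_mk_segment_left]
      rintro ⟨s, -, h⟩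
      exact ht0.ne (congrArg Prod.snd h)
    · intro h
      have := (Prod.mk.inj h).2
      linarith [ht.2]
  have hx' : ∀ x x' y, 0 ≤ x → x ≤ x' → |y| + k * x' ≤ b → u (x', y) ≤ u (x, y) := by
    intro x x' y h0 h1 h2
    rcases h1.eq_or_lt with rfl | h1
    · exact le_rfl
    · exact (hx x x' y h0 h1 h2).le
  have hTo := isOpen_isoscelesTriangle k b
  have hlo : IsOpen (isoscelesTriangle k b ∩ {p | u p < a}) :=
    hTo.inter (isOpen_lt huc continuous_const)
  have hhi : IsOpen {p | a < u p} := isOpen_lt continuous_const huc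
  have h10 : ((1, 0) : ℝ × ℝ) ∈ isoscelesTriangle k b := ⟨one_pos, by simpa using hkb⟩
  refine ⟨fun ha => ?_, fun ha => ?_, fun ha => ?_⟩
  · refine card_connectedComponents_of_iUnion (fun _ : Fin 1 => isoscelesTriangle k b)
      (fun _ => hTo) (fun _ => hconv.isPreconnected)
      (fun _ => ⟨_, h10⟩) (fun i j _ _ _ => Subsingleton.elim i j) fun p => ?_
    refine ⟨fun h => ⟨0, h.1⟩, fun ⟨_, h⟩ => ⟨h, ?_⟩⟩
    obtain ⟨x, y⟩ := p
    obtain ⟨h1, h2⟩ := h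
    dsimp only at h1 h2
    rcases ha with ha | ha
    · have hxs : x < √3 := by nlinarith [abs_nonneg y]
      have h3 := hx x √3 0 h1.le hxs (by simp [hk])
      have h4 := hy x 0 y h1.le (by simp) h2.le
      exact (ha.trans_lt (h3.trans_le h4)).ne'
    · have h3 := hx 0 x y le_rfl h1 h2.le
      have h5 : |y| ≤ b := by nlinarith
      have h4 := hy 0 y b le_rfl (by rwa [abs_of_pos hb0]) (by simp [abs_of_pos hb0])
      exact ((h3.trans_le h4).trans_le ha).ne
  · have hline : Continuous fun t : ℝ => u (t, 0) := huc.comp (by fun_prop)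
    obtain ⟨ε, hεa, hε0, hε1⟩ : ∃ ε, a < u (ε, 0) ∧ ε ∈ Ioo (0 : ℝ) 1 :=
      (((hline.tendsto 0).mono_left nhdsWithin_le_nhds).eventually_const_lt
        (hO ▸ ha.2) |>.and (Ioo_mem_nhdsGT one_pos)).exists
    obtain ⟨t, hta, ht0, hts⟩ : ∃ t, u (t, 0) < a ∧ t ∈ Ioo 0 √3 :=
      (((hline.tendsto √3).mono_left nhdsWithin_le_nhds).eventually_lt_const
        ha.1 |>.and (Ioo_mem_nhdsLT hs)).exists
    have hεb : k * ε < b := by nlinarith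
    refine card_connectedComponents_of_iUnion
      ![isoscelesTriangle k b ∩ {p | u p < a}, isoscelesTriangle k b ∩ {p | a < u p}]
      ?_ ?_ ?_ ?_ ?_
    · simpa [Fin.forall_fin_two] using ⟨hlo, hTo.inter hhi⟩
    · simpa [Fin.forall_fin_two] using
        ⟨isPreconnected_sublevel hk0 hx' hy a, isPreconnected_superlevel hk0 hx' hy hε0 hεb hεa⟩
    · rw [Fin.forall_fin_two]
      refine ⟨⟨(t, 0), ⟨ht0, ?_⟩, hta⟩, ⟨(ε, 0), ⟨hε0, ?_⟩, hεa⟩⟩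
      · simp only [abs_zero]
        nlinarith
      · simpa using hεb
    · intro i j p hi hj
      fin_cases i <;> fin_cases j <;> first
        | rfl
        | (simp at hi hj; linarith)
    · intro p
      simp [Fin.exists_fin_two, ← and_or_left]
  · have hmir : Continuous fun p : ℝ × ℝ => (p.1, -p.2) := by fun_prop
    have hup := isPreconnected_upper_superlevel hk0 hx' hy a
    have himg : (fun p : ℝ × ℝ => (p.1, -p.2)) ''
        (isoscelesTriangle k b ∩ {p | 0 < p.2 ∧ a < u p}) =
        isoscelesTriangle k b ∩ {p | p.2 < 0 ∧ a < u p} := by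
      ext ⟨x, y⟩
      constructor
      · rintro ⟨⟨x, y⟩, ⟨⟨h1, h2⟩, h3, h4⟩, h⟩
        obtain ⟨rfl, rfl⟩ := Prod.mk.inj h
        exact ⟨⟨h1, by simpa using h2⟩, by simpa using h3, by simpa [heven] using h4⟩
      · rintro ⟨⟨h1, h2⟩, h3, h4⟩
        exact ⟨(x, -y), ⟨⟨h1, by simpa using h2⟩, by simpa using h3, by simpa [heven] using h4⟩,
          by simp⟩
    have hupne : (isoscelesTriangle k b ∩ {p | 0 < p.2 ∧ a < u p}).Nonempty := by
      obtain ⟨p, hp, hpT, hp0⟩ := mem_closure_iff.1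
        (mem_closure_upper_isoscelesTriangle hkb hb0 le_rfl) _ hhi ha.2
      exact ⟨p, hpT, hp0, hp⟩
    have haxis : ∀ x, 0 < x → k * x < b → u (x, 0) < a := fun x h1 h2 =>
      (hx 0 x 0 le_rfl h1 (by simpa using h2.le)).trans_le (hO.trans_le ha.1)
    refine card_connectedComponents_of_iUnion
      ![isoscelesTriangle k b ∩ {p | u p < a}, isoscelesTriangle k b ∩ {p | 0 < p.2 ∧ a < u p},
        isoscelesTriangle k b ∩ {p | p.2 < 0 ∧ a < u p}] ?_ ?_ ?_ ?_ ?_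
    · simpa [Fin.forall_fin_succ] using
        ⟨hlo, hTo.inter ((isOpen_lt continuous_const continuous_snd).inter hhi),
          hTo.inter ((isOpen_lt continuous_snd continuous_const).inter hhi)⟩
    · simpa [Fin.forall_fin_succ] using ⟨isPreconnected_sublevel hk0 hx' hy a, hup,
        himg ▸ hup.image _ hmir.continuousOn⟩
    · simpa [Fin.forall_fin_succ] using
        ⟨⟨(1, 0), h10, haxis 1 one_pos (by simpa using hkb)⟩, hupne, himg ▸ hupne.image _⟩
    · intro i j p hi hj
      fin_cases i <;> fin_cases j <;> first
        | rfl
        | (simp at hi hj; linarith)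
    · rintro ⟨x, y⟩
      simp only [Fin.exists_fin_succ, Matrix.cons_val_zero, Matrix.cons_val_succ, mem_inter_iff,
        mem_ofPred_eq, IsEmpty.exists_iff, or_false, ← and_or_left,
        ← or_and_right]
      refine and_congr_right fun hT => ⟨fun h => ?_, ?_⟩
      · rcases h.lt_or_gt with h | h
        · exact Or.inl h
        · refine Or.inr ⟨?_, h⟩
          rcases lt_trichotomy y 0 with h0 | rfl | h0
          · exact Or.inr h0
          · exact absurd (h.trans (haxis x hT.1 (by simpa using hT.2))) (lt_irrefl _)
          · exact Or.inl h0
      · rintro (h | ⟨-, h⟩)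
        · exact h.ne
        · exact h.ne'
end
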